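/- arXiv:1909.01384 — 6 statements merged into one kernel-verified Lean document; each statement's English description precedes it below -/
import Mathlib

section
/- Let (A,σ) be a semisimple artinian ring with involution such that 2 ∈ A^×. Then the subgroup of U(A,σ) generated by the elements s_{y,a}, where y ∈ A, a ∈ Sym_{−1}(A,σ) and ½σ(y)y + a ∈ A^×, contains the subgroup U^0(A,σ). -/
universe v

/-- Membership in the group `U⁰(A,σ)` for a ring with involution `(A,σ)`:
`σ(u)u = 1`, and for every quotient of `(A,σ)` which is a split central simple algebra
over a field with an induced (first-kind) involution of orthogonal type, the image of `u`
has determinant (= reduced norm) `1`. For a semisimple artinian ring `A` this is exactly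
the subgroup `U⁰(A,σ)` obtained from the decomposition of `(A,σ)` into simple factors and
factors of the form `B × Bᵒᵖ` with the exchange involution. -/
def U0Mem {A : Type v} [Ring A] (σ : A → A) (u : A) : Prop :=
  σ u * u = 1 ∧
    ∀ (n : ℕ) (k : Type v) [Field k] (π : A →+* Matrix (Fin n) (Fin n) k)
      (τ : Matrix (Fin n) (Fin n) k → Matrix (Fin n) (Fin n) k),
      Function.Surjective π →
      (∀ x : A, π (σ x) = τ (π x)) →
      (∀ X Y, τ (X + Y) = τ X + τ Y) →
      (∀ X Y, τ (X * Y) = τ Y * τ X) →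
      (∀ X, τ (τ X) = X) →
      (∀ c : k, τ (c • (1 : Matrix (Fin n) (Fin n) k)) = c • 1) →
      2 * Module.finrank k (Submodule.span k {X | τ X = X}) = n * (n + 1) →
      Matrix.det (π u) = 1

section Matrix
variable {n : ℕ} {D : Type*}

open Matrix

/-- The ring of matrices over a division ring is prime. -/
theorem Matrix.exists_mul_mul_ne_zero [DivisionRing D] {M N : Matrix (Fin n) (Fin n) D}
    (hM : M ≠ 0) (hN : N ≠ 0) : ∃ t, M * t * N ≠ 0 := by
  obtain ⟨i, j, hij⟩ : ∃ i j, M i j ≠ 0 := by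
    by_contra! h
    exact hM (Matrix.ext h)
  obtain ⟨k, l, hkl⟩ : ∃ i j, N i j ≠ 0 := by
    by_contra! h
    exact hN (Matrix.ext h)
  refine ⟨single j k 1, fun h => mul_ne_zero hij hkl ?_⟩
  have := congrFun (congrFun h i) l
  rw [Matrix.mul_assoc, Matrix.mul_apply, Finset.sum_eq_single j] at this
  · simpa using this
  · intro b _ hb
    rw [single_mul_apply_of_ne _ _ _ _ _ hb, mul_zero]
  · simp

/-- An additive, multiplication-reversing, involutive map. -/
structure IsRingInvolution {R : Type*} [Ring R] (τ : R → R) : Prop where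
  protected map_add : ∀ x y, τ (x + y) = τ x + τ y
  protected map_mul : ∀ x y, τ (x * y) = τ y * τ x
  protected invol : ∀ x, τ (τ x) = x

namespace IsRingInvolution

variable {R : Type*} [Ring R] {τ : R → R}

protected theorem map_zero (h : IsRingInvolution τ) : τ 0 = 0 := by
  simpa using h.map_add 0 0

protected theorem map_neg (h : IsRingInvolution τ) (x : R) : τ (-x) = -τ x := by
  refine eq_neg_of_add_eq_zero_left ?_
  rw [← h.map_add, neg_add_cancel, h.map_zero]

protected theorem map_sub (h : IsRingInvolution τ) (x y : R) : τ (x - y) = τ x - τ y := by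
  rw [sub_eq_add_neg, h.map_add, h.map_neg, sub_eq_add_neg]

protected theorem map_one (h : IsRingInvolution τ) : τ 1 = 1 := by
  have := h.map_mul (τ 1) 1
  rwa [mul_one, h.invol, mul_one, eq_comm] at this

protected theorem map_eq_zero (h : IsRingInvolution τ) {x : R} : τ x = 0 ↔ x = 0 :=
  ⟨fun hx => by rw [← h.invol x, hx, h.map_zero], fun hx => by rw [hx, h.map_zero]⟩

end IsRingInvolution

/-- Every element of `h R τ(h)` is `τ`-symmetric. -/
def IsSymmetricCorner {R : Type*} [Ring R] (τ : R → R) (h : R) : Prop :=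
  ∀ x, h * x * τ h = h * τ x * τ h

theorem IsSymmetricCorner.mul_left {R : Type*} [Ring R] {τ : R → R} (hτ : IsRingInvolution τ)
    {h : R} (hh : IsSymmetricCorner τ h) (z : R) : IsSymmetricCorner τ (z * h) := fun x => by
  have := congrArg (fun m => z * m * τ z) (hh x)
  simpa only [hτ.map_mul, mul_assoc] using this

theorem IsSymmetricCorner.mul_right {R : Type*} [Ring R] {τ : R → R} (hτ : IsRingInvolution τ)
    {h : R} (hh : IsSymmetricCorner τ h) (z : R) : IsSymmetricCorner τ (h * z) := fun x => by
  have := hh (z * x * τ z)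
  simpa only [hτ.map_mul, hτ.invol, mul_assoc] using this

theorem IsSymmetricCorner.map_eq {R : Type*} [Ring R] {τ : R → R} (hτ : IsRingInvolution τ)
    {h : R} (hh : IsSymmetricCorner τ h) (x : R) : τ (h * x * τ h) = h * x * τ h := by
  rw [hτ.map_mul, hτ.map_mul, hτ.invol, ← mul_assoc, ← hh x]

theorem IsSymmetricCorner.matrix_single [DivisionRing D]
    {τ : Matrix (Fin n) (Fin n) D → Matrix (Fin n) (Fin n) D} (hτ : IsRingInvolution τ)
    {h : Matrix (Fin n) (Fin n) D} (h0 : h ≠ 0) (hh : IsSymmetricCorner τ h) (b : Fin n) :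
    IsSymmetricCorner τ (single b b 1) := by
  obtain ⟨i, j, hij⟩ : ∃ i j, h i j ≠ 0 := by
    by_contra! h
    exact h0 (Matrix.ext h)
  have : single b b (1 : D) = single b i (h i j)⁻¹ * h * single j b 1 := by
    rw [Matrix.single_mul_mul_single, inv_mul_cancel₀ hij, one_mul]
  rw [this]
  exact (hh.mul_left hτ _).mul_right hτ _

theorem IsSymmetricCorner.commute [DivisionRing D]
    {τ : Matrix (Fin n) (Fin n) D → Matrix (Fin n) (Fin n) D} (hτ : IsRingInvolution τ)
    {h : Matrix (Fin n) (Fin n) D} (h0 : h ≠ 0) (hh : IsSymmetricCorner τ h) (α β : D) :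
    α * β = β * α := by
  obtain ⟨b⟩ : Nonempty (Fin n) := by
    by_contra hb
    exact h0 (Matrix.ext fun i _ => (hb ⟨i⟩).elim)
  have hE := hh.matrix_single hτ h0 b
  set E : Matrix (Fin n) (Fin n) D := Matrix.single b b 1 with hEdef
  have hE0 : E ≠ 0 := fun h => one_ne_zero (α := D) (by
    simpa [hEdef] using congrFun (congrFun h b) b)
  obtain ⟨t, ht⟩ := Matrix.exists_mul_mul_ne_zero hE0 (mt hτ.map_eq_zero.1 hE0)
  set p := E * t * τ E with hp
  have hpsym : τ p = p := hE.map_eq hτ t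
  have hEE : E * E = E := by simp [hEdef]
  have key : ∀ x, E * x = x → x * E = x → x * p = p * τ x := fun x h1 h2 => by
    have h3 : x * p = E * (x * t) * τ E := by
      rw [hp, ← Matrix.mul_assoc, ← Matrix.mul_assoc, ← Matrix.mul_assoc, h2, h1]
    rw [← hpsym, ← hτ.map_mul, hpsym, h3, hE.map_eq hτ]
  have hx : ∀ α : D, E * Matrix.single b b α = Matrix.single b b α := fun α => by simp [hEdef]
  have hx' : ∀ α : D, Matrix.single b b α * E = Matrix.single b b α := fun α => by simp [hEdef]
  have hcomm : Matrix.single b b (α * β) * p = Matrix.single b b (β * α) * p := by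
    have hs : ∀ α β : D, Matrix.single b b (α * β) = Matrix.single b b α * Matrix.single b b β :=
      fun α β => by simp
    calc Matrix.single b b (α * β) * p = p * τ (Matrix.single b b (β * α)) := by
          rw [hs, hs, hτ.map_mul, Matrix.mul_assoc, key _ (hx β) (hx' β), ← Matrix.mul_assoc,
            key _ (hx α) (hx' α), Matrix.mul_assoc]
      _ = _ := (key _ (hx _) (hx' _)).symm
  by_contra hne
  refine ht ?_
  have hEp : E * p = p := by rw [hp, ← Matrix.mul_assoc, ← Matrix.mul_assoc, hEE]
  have hδ : Matrix.single b b (α * β - β * α) * p = 0 := by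
    rw [← Matrix.singleAddMonoidHom_apply, map_sub, Matrix.singleAddMonoidHom_apply,
      Matrix.singleAddMonoidHom_apply, Matrix.sub_mul, hcomm, sub_self]
  have := congrArg (Matrix.single b b (α * β - β * α)⁻¹ * ·) hδ
  simpa only [← Matrix.mul_assoc, Matrix.single_mul_single_same, Matrix.mul_zero,
    inv_mul_cancel₀ (sub_ne_zero.2 hne), ← hEdef, hEp] using this

section Field

variable {k : Type*} [Field k] {τ : Matrix (Fin n) (Fin n) k → Matrix (Fin n) (Fin n) k}

theorem IsSymmetricCorner.map_smul_one (hτ : IsRingInvolution τ)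
    {h : Matrix (Fin n) (Fin n) k} (h0 : h ≠ 0) (hh : IsSymmetricCorner τ h) (c : k) :
    τ (c • (1 : Matrix (Fin n) (Fin n) k)) = c • 1 := by
  obtain ⟨t, ht⟩ := Matrix.exists_mul_mul_ne_zero h0 (mt hτ.map_eq_zero.1 h0)
  set z : Matrix (Fin n) (Fin n) k := c • 1 with hz
  have hzc : ∀ x, z * x = x * z := fun x => by simp [hz]
  have hzc' : ∀ x, τ z * x = x * τ z := fun x => by
    rw [← hτ.invol x, ← hτ.map_mul, ← hzc, hτ.map_mul]
  have hsym : h * t * τ h * z = h * t * τ h * τ z := by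
    have h1 : h * t * τ h * z = h * (z * t) * τ h := by
      rw [← hzc, ← Matrix.mul_assoc h, ← hzc h]
      simp only [Matrix.mul_assoc]
    rw [h1, ← hh.map_eq hτ, ← h1, hτ.map_mul, hh.map_eq hτ, hzc']
  by_contra hne
  obtain ⟨s, hs⟩ := Matrix.exists_mul_mul_ne_zero ht (sub_ne_zero.2 hne)
  apply hs
  rw [Matrix.mul_assoc, Matrix.mul_sub, ← hzc, ← hzc', ← Matrix.sub_mul, ← Matrix.mul_assoc,
    Matrix.mul_sub, hsym, sub_self, Matrix.zero_mul]

/-- An involution with a nonzero symmetric corner is adjoint to a symmetric bilinear form. -/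
theorem IsSymmetricCorner.exists_form (hτ : IsRingInvolution τ)
    {h : Matrix (Fin n) (Fin n) k} (h0 : h ≠ 0) (hh : IsSymmetricCorner τ h) :
    ∃ S : Matrix (Fin n) (Fin n) k, Sᵀ = S ∧ IsUnit S.det ∧ ∀ X, X * S = S * (τ X)ᵀ := by
  obtain ⟨b⟩ : Nonempty (Fin n) := by
    by_contra hb
    exact h0 (Matrix.ext fun i _ => (hb ⟨i⟩).elim)
  have hE := hh.matrix_single hτ h0 b
  have hE0 : (Matrix.single b b 1 : Matrix (Fin n) (Fin n) k) ≠ 0 := fun h =>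
    one_ne_zero (α := k) (by simpa using congrFun (congrFun h b) b)
  obtain ⟨i, r, hir⟩ : ∃ i r, τ (Matrix.single b b 1) i r ≠ 0 := by
    by_contra! h
    exact hE0 (hτ.map_eq_zero.1 (Matrix.ext h))
  have hlin : ∀ (c : k) X, τ (c • X) = c • τ X := fun c X => by
    rw [← Matrix.one_mul X, ← Matrix.smul_mul, hτ.map_mul, hh.map_smul_one hτ h0, Matrix.one_mul,
      Matrix.mul_smul, Matrix.mul_one]
  have hS : ∀ X, X * Matrix.of (fun i j => τ (Matrix.single b j 1) i r) =
      Matrix.of (fun i j => τ (Matrix.single b j 1) i r) * (τ X)ᵀ := fun X => by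
    ext i j
    have h1 : (Matrix.single b j 1 : Matrix (Fin n) (Fin n) k) * τ X =
        ∑ l, τ X j l • Matrix.single b l 1 := by
      ext p q
      by_cases hp : p = b
      · subst hp
        simp [Matrix.sum_apply, Matrix.single_apply]
      · simp [Matrix.sum_apply, hp, Ne.symm hp]
    let τ' : Matrix (Fin n) (Fin n) k →+ Matrix (Fin n) (Fin n) k :=
      ⟨⟨τ, hτ.map_zero⟩, hτ.map_add⟩
    have h2 : X * τ (Matrix.single b j 1) = ∑ l, τ X j l • τ (Matrix.single b l 1) := by
      have : τ' (∑ l, τ X j l • Matrix.single b l 1) = ∑ l, τ X j l • τ (Matrix.single b l 1) := by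
        rw [map_sum]
        exact Finset.sum_congr rfl fun l _ => hlin _ _
      rw [← this, ← h1]
      exact (by rw [hτ.map_mul, hτ.invol] : _ = τ (Matrix.single b j 1 * τ X))
    have h3 := congrFun (congrFun h2 i) r
    simpa [Matrix.mul_apply, Matrix.sum_apply, mul_comm] using h3
  refine ⟨_, ?_, ?_, hS⟩
  · ext i j
    have hb : ∀ j, (Matrix.single b j 1 : Matrix (Fin n) (Fin n) k) =
        Matrix.single b b 1 * Matrix.single b j 1 := fun j => by simp
    have h1 : Matrix.single b i 1 * τ (Matrix.single b j 1) =
        Matrix.single b j 1 * τ (Matrix.single b i 1) := by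
      have := hE (Matrix.single b i 1 * τ (Matrix.single b j 1))
      rw [hτ.map_mul, hτ.invol] at this
      rwa [← Matrix.mul_assoc, ← hb, Matrix.mul_assoc, ← hτ.map_mul, ← hb, ← Matrix.mul_assoc,
        ← hb, Matrix.mul_assoc, ← hτ.map_mul, ← hb] at this
    simpa using (congrFun (congrFun h1 b) r).symm
  · rw [isUnit_iff_ne_zero]
    intro hdet
    obtain ⟨v, hv, hv0⟩ := Matrix.exists_vecMul_eq_zero_iff.2 hdet
    set S := Matrix.of (fun i j => τ (Matrix.single b j 1) i r) with hSdef
    have hS0 : S ≠ 0 := fun h => hir (congrFun (congrFun h i) b)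
    have hM0 : Matrix.replicateRow (Fin n) v ≠ 0 := fun h => hv (congrFun h b)
    obtain ⟨t, ht⟩ := Matrix.exists_mul_mul_ne_zero hM0 hS0
    apply ht
    have hz : Matrix.replicateRow (Fin n) v * S = 0 := by
      ext p q
      exact congrFun hv0 q
    rw [Matrix.mul_assoc, hS, ← Matrix.mul_assoc, hz, Matrix.zero_mul]

theorem Matrix.det_map_of_form {S : Matrix (Fin n) (Fin n) k} (hS : IsUnit S.det)
    (hτS : ∀ X, X * S = S * (τ X)ᵀ) (X : Matrix (Fin n) (Fin n) k) : (τ X).det = X.det := by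
  have := congrArg Matrix.det (hτS X)
  rw [Matrix.det_mul, Matrix.det_mul, Matrix.det_transpose, mul_comm] at this
  exact (hS.mul_left_cancel this).symm

/-- The space of symmetric elements of an involution adjoint to a symmetric bilinear form. -/
theorem Matrix.finrank_span_symmetric_of_form {S : Matrix (Fin n) (Fin n) k} (hSt : Sᵀ = S)
    (hS : IsUnit S.det) (hτS : ∀ X, X * S = S * (τ X)ᵀ) :
    2 * Module.finrank k (Submodule.span k {X | τ X = X}) = n * (n + 1) := by
  let φ : (Sym2 (Fin n) → k) →ₗ[k] Matrix (Fin n) (Fin n) k :=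
    { toFun := fun q => Matrix.of (fun i j => q s(i, j)) * S⁻¹
      map_add' := fun p q => by rw [← Matrix.add_mul]; rfl
      map_smul' := fun c q => by rw [RingHom.id_apply, ← Matrix.smul_mul]; rfl }
  have hφ : Function.Injective φ := fun p q hpq => by
    have h1 : Matrix.of (fun i j => p s(i, j)) = Matrix.of (fun i j => q s(i, j)) := by
      have := congrArg (· * S) hpq
      simpa only [φ, LinearMap.coe_mk, AddHom.coe_mk, Matrix.mul_assoc,
        Matrix.nonsing_inv_mul S hS, Matrix.mul_one] using this
    funext z
    induction z using Sym2.ind with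
    | _ i j => exact congrFun (congrFun h1 i) j
  have hmem : ∀ X, τ X = X ↔ (X * S)ᵀ = X * S := fun X => by
    have h1 : (X * S)ᵀ = τ X * S := by
      rw [hτS X, Matrix.transpose_mul, Matrix.transpose_transpose, hSt]
    rw [h1]
    refine ⟨fun h => by rw [h], fun h => ?_⟩
    have := congrArg (· * S⁻¹) h
    simpa only [Matrix.mul_assoc, Matrix.mul_nonsing_inv S hS, Matrix.mul_one] using this
  have hset : {X | τ X = X} = (LinearMap.range φ : Set (Matrix (Fin n) (Fin n) k)) := by
    ext X
    rw [Set.mem_ofPred_eq, hmem, SetLike.mem_coe, LinearMap.mem_range]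
    constructor
    · intro h
      refine ⟨Sym2.lift ⟨fun i j => (X * S) i j, fun i j => congrFun (congrFun h j) i⟩, ?_⟩
      change (X * S) * S⁻¹ = X
      rw [Matrix.mul_assoc, Matrix.mul_nonsing_inv S hS, Matrix.mul_one]
    · rintro ⟨q, rfl⟩
      change (Matrix.of (fun i j => q s(i, j)) * S⁻¹ * S)ᵀ = _ * S⁻¹ * S
      rw [Matrix.mul_assoc, Matrix.nonsing_inv_mul S hS, Matrix.mul_one]
      ext i j
      exact congrArg q Sym2.eq_swap
  rw [hset, Submodule.span_eq, LinearMap.finrank_range_of_inj hφ, Module.finrank_fintype_fun_eq_card,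
    Sym2.card, Fintype.card_fin, Nat.choose_two_right, Nat.add_sub_cancel,
    Nat.mul_div_cancel' (by rw [mul_comm]; exact (Nat.even_mul_succ_self n).two_dvd), mul_comm]

/-- A symmetric corner of an involution adjoint to a symmetric form has rank at most one. -/
theorem IsSymmetricCorner.mul_apply_eq {S : Matrix (Fin n) (Fin n) k} (hSt : Sᵀ = S)
    (hS : IsUnit S.det) (hτS : ∀ X, X * S = S * (τ X)ᵀ) {g : Matrix (Fin n) (Fin n) k}
    (hg : IsSymmetricCorner τ g) (i j a b : Fin n) : g i a * g j b = g i b * g j a := by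
  have hτS' : ∀ X, τ X * S = (X * S)ᵀ := fun X => by
    rw [hτS X, Matrix.transpose_mul, Matrix.transpose_transpose, hSt]
  have h1 : τ g * S = S * gᵀ := by rw [hτS', Matrix.transpose_mul, hSt]
  have key : ∀ x, g * (x * S) * gᵀ = g * (x * S)ᵀ * gᵀ := fun x => by
    have := congrArg (· * S) (hg x)
    simpa only [Matrix.mul_assoc, h1, ← hτS'] using this
  have h2 := key (Matrix.single a b 1 * S⁻¹)
  rw [Matrix.mul_assoc _ S⁻¹ S, Matrix.nonsing_inv_mul S hS, Matrix.mul_one] at h2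
  have h3 := congrFun (congrFun h2 i) j
  simpa [Matrix.mul_apply, Matrix.single_apply, Finset.sum_ite, ite_and] using h3

theorem Matrix.det_one_sub_two_mul_of_rank_one {g : Matrix (Fin n) (Fin n) k} (hg : g * g = g)
    (h0 : g ≠ 0) (h : ∀ i j a b, g i a * g j b = g i b * g j a) : (1 - 2 * g).det = -1 := by
  obtain ⟨r, c, hrc⟩ : ∃ i j, g i j ≠ 0 := by
    by_contra! h
    exact h0 (Matrix.ext h)
  have h1 : 2 * g = Matrix.replicateCol Unit (fun i => g i c) *
      Matrix.replicateRow Unit (fun a => 2 * (g r a / g r c)) := by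
    ext i a
    rw [two_mul]
    simp only [Matrix.add_apply, Matrix.mul_apply, Matrix.replicateCol_apply,
      Matrix.replicateRow_apply, Finset.univ_unique, Finset.sum_singleton]
    field_simp
    linear_combination 2 * h i r a c
  have h2 : ∑ a, 2 * (g r a / g r c) * g a c = 2 := by
    have h3 := congrFun (congrFun hg r) c
    rw [Matrix.mul_apply] at h3
    have h4 : ∀ a, 2 * (g r a / g r c) * g a c = (2 / g r c) * (g r a * g a c) := fun a => by ring
    simp_rw [h4, ← Finset.mul_sum, h3]
    field_simp
  rw [h1, Matrix.det_one_sub_mul_comm, Matrix.det_unique]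
  simp only [Matrix.sub_apply, Matrix.one_apply_eq, Matrix.mul_apply, Matrix.replicateCol_apply,
    Matrix.replicateRow_apply, h2]
  norm_num

end Field

end Matrix

section Ring

variable {A : Type*} [Ring A]

theorem IsSemisimpleRing.isUnit_of_forall_mul_eq_zero [IsSemisimpleRing A] {c : A}
    (hc : ∀ x, x * c = 0 → x = 0) : IsUnit c :=
  IsArtinianRing.isUnit_iff_isRightRegular.2 fun x y hxy =>
    sub_eq_zero.1 (hc _ (by rw [sub_mul, sub_eq_zero]; exact hxy))

theorem IsSemisimpleRing.exists_annihilator_generator [IsSemisimpleRing A] (c : A) :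
    ∃ g, g * c = 0 ∧ ∀ x, x * c = 0 → x * g = x := by
  obtain ⟨g, hg, hI⟩ := IsSemisimpleRing.ideal_eq_span_idempotent
    (LinearMap.ker (LinearMap.toSpanSingleton A A c))
  have hmem : ∀ x, x * c = 0 ↔ ∃ a, a * g = x := fun x => by
    rw [← Ideal.mem_span_singleton', ← hI, LinearMap.mem_ker, LinearMap.toSpanSingleton_apply,
      smul_eq_mul]
  refine ⟨g, (hmem g).2 ⟨1, one_mul g⟩, fun x hx => ?_⟩
  obtain ⟨a, rfl⟩ := (hmem x).1 hx
  rw [mul_assoc, hg.eq]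

/-- For `w = 1 - u` with `u` unitary and `f` an idempotent generating the left annihilator of `w`,
`b` is a skew element of the corner `f A σ(f)`, and `g` generates the left annihilator of
`σ(w) + b`, where `b` is maximal in the sense that `g A σ(g)` contains no nonzero skew element. -/
structure IsMaximalSkew (σ : A → A) (w f b g : A) : Prop where
  f_mul_w : f * w = 0
  f_mul_map_w : f * σ w = 0
  f_mul_b : f * b = b
  map_b : σ b = -b
  f_mul_g : f * g = g
  g_mul_f : g * f = g
  g_mul_b : g * b = 0
  mul_g : ∀ x, x * (σ w + b) = 0 → x * g = x
  corner : IsSymmetricCorner σ g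

variable {σ : A → A}

theorem IsRingInvolution.exists_isMaximalSkew [IsSemisimpleRing A] (hσ : IsRingInvolution σ) {w : A}
    (hw : ∀ x, x * w = 0 → x * σ w = 0) (hw' : ∀ x, x * σ w = 0 → x * w = 0) :
    ∃ f b g, IsMaximalSkew σ w f b g := by
  obtain ⟨f, hfw, hf⟩ := IsSemisimpleRing.exists_annihilator_generator w
  have hfw' := hw f hfw
  let I : A → Ideal A := fun b => LinearMap.ker (LinearMap.toSpanSingleton A A (σ w + b))
  have hI : ∀ b x, x ∈ I b ↔ x * (σ w + b) = 0 := fun b x => by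
    rw [LinearMap.mem_ker, LinearMap.toSpanSingleton_apply, smul_eq_mul]
  obtain ⟨_, ⟨b, ⟨hb, hfb⟩, rfl⟩, hmin⟩ := (wellFounded_lt (α := Ideal A)).has_min
    (I '' {b | σ b = -b ∧ f * b = b}) ⟨I 0, 0, by simp [hσ.map_zero], rfl⟩
  obtain ⟨e, hec, he⟩ := IsSemisimpleRing.exists_annihilator_generator (σ w + b)
  have hwf : σ w * σ f = 0 := by rw [← hσ.map_mul, hfw, hσ.map_zero]
  have hbf : b * σ f = b := by
    rw [← neg_inj, ← neg_mul, ← hb, ← hσ.map_mul, hfb]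
  have split : ∀ x, x * (σ w + b) = 0 → x * b = 0 ∧ x * σ w = 0 := fun x hx => by
    have h1 : x * b = 0 := by
      have := congrArg (· * σ f) hx
      simpa only [mul_assoc, add_mul, hwf, hbf, zero_add, zero_mul] using this
    exact ⟨h1, by simpa [mul_add, h1] using hx⟩
  obtain ⟨heb, hew⟩ := split e hec
  have hef : e * f = e := hf e (hw' e hew)
  have hgf : f * e * f = f * e := by rw [mul_assoc, hef]
  have hgb : f * e * b = 0 := by rw [mul_assoc, heb, mul_zero]
  have hgw : f * e * w = 0 := by rw [mul_assoc, hw' e hew, mul_zero]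
  have hgw' : f * e * σ w = 0 := by rw [mul_assoc, hew, mul_zero]
  have hff : f * f = f := hf f hfw
  have hfg : f * (f * e) = f * e := by rw [← mul_assoc, hff]
  have hmul : ∀ x, x * (σ w + b) = 0 → x * (f * e) = x := fun x hx => by
    obtain ⟨h1, h2⟩ := split x hx
    rw [← mul_assoc, hf x (hw' x h2), he x hx]
  refine ⟨f, b, f * e, hfw, hfw', hfb, hb, hfg, hgf, hgb, hmul, ?_⟩
  set g := f * e
  clear_value g
  have hgg : g * g = g := hmul g (by rw [mul_add, hgb, hgw', add_zero])
  have hwg : σ w * σ g = 0 := by rw [← hσ.map_mul, hgw, hσ.map_zero]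
  have hbg : b * σ g = 0 := by
    rw [← neg_inj, ← neg_mul, ← hb, ← hσ.map_mul, hgb, hσ.map_zero, neg_zero]
  have key : ∀ t, σ t = -t → g * t * σ g = 0 := fun t ht => by
    set d := g * t * σ g with hd
    have hdg : d * σ g = d := by rw [hd, mul_assoc, ← hσ.map_mul, hgg]
    have hgd : g * d = d := by rw [hd, ← mul_assoc, ← mul_assoc, hgg]
    have hds : σ d = -d := by
      rw [hd, hσ.map_mul, hσ.map_mul, hσ.invol, ht]
      simp only [mul_neg, neg_mul, mul_assoc]
    have hmem : I (b + d) ∈ I '' {b | σ b = -b ∧ f * b = b} := by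
      refine ⟨b + d, ⟨?_, ?_⟩, rfl⟩
      · rw [hσ.map_add, hb, hds, neg_add]
      · rw [mul_add, hfb, hd, ← mul_assoc, ← mul_assoc, hfg]
    have hxd : ∀ x, x * (σ w + (b + d)) = 0 → x * d = 0 := fun x hx => by
      have := congrArg (· * σ g) hx
      simpa only [mul_assoc, add_mul, hwg, hbg, hdg, zero_add, zero_mul] using this
    have hle : I (b + d) ≤ I b := fun x hx => by
      rw [hI] at hx ⊢
      have := hxd x hx
      rwa [← add_assoc, mul_add, this, add_zero] at hx
    have hge : I b ≤ I (b + d) := by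
      by_contra h
      exact hmin _ hmem (lt_of_le_not_ge hle h)
    have hgI : g ∈ I (b + d) := hge ((hI _ _).2 (by rw [mul_add, hgb, hgw', add_zero]))
    rw [← hgd]
    exact hxd g ((hI _ _).1 hgI)
  intro t
  have := key (t - σ t) (by rw [hσ.map_sub, hσ.invol, neg_sub])
  rwa [mul_sub, sub_mul, sub_eq_zero] at this

namespace IsMaximalSkew

variable {w f b g : A}

theorem g_mul_w (h : IsMaximalSkew σ w f b g) : g * w = 0 := by
  rw [← h.g_mul_f, mul_assoc, h.f_mul_w, mul_zero]

theorem g_mul_map_w (h : IsMaximalSkew σ w f b g) : g * σ w = 0 := by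
  rw [← h.g_mul_f, mul_assoc, h.f_mul_map_w, mul_zero]

theorem g_mul_self (h : IsMaximalSkew σ w f b g) : g * g = g :=
  h.mul_g g (by rw [mul_add, h.g_mul_b, h.g_mul_map_w, add_zero])

theorem b_mul_map_f (h : IsMaximalSkew σ w f b g) (hσ : IsRingInvolution σ) : b * σ f = b := by
  rw [← neg_inj, ← neg_mul, ← h.map_b, ← hσ.map_mul, h.f_mul_b]

theorem mul_one_sub (h : IsMaximalSkew σ w f b g) (hσ : IsRingInvolution σ) :
    (σ w + b) * (1 - σ f) = σ w := by
  rw [mul_sub, mul_one, add_mul, h.b_mul_map_f hσ, ← hσ.map_mul, h.f_mul_w, hσ.map_zero]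
  abel

theorem w_mul_one_sub (h : IsMaximalSkew σ w f b g) (hσ : IsRingInvolution σ) :
    w * (1 - σ f) = w := by
  have : w * σ f = 0 := by rw [← hσ.invol w, ← hσ.map_mul, h.f_mul_map_w, hσ.map_zero]
  rw [mul_sub, mul_one, this, sub_zero]

theorem map_g_mul_of_mul_eq_zero (h : IsMaximalSkew σ w f b g) (hσ : IsRingInvolution σ)
    (hw : ∀ x, x * w = 0 → x * σ w = 0) {x : A} (hx : (σ w + b) * x = 0) : σ g * x = x := by
  have h1 : b * x = 0 := by
    have := congrArg (f * ·) hx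
    simpa only [← mul_assoc, mul_add, h.f_mul_map_w, h.f_mul_b, zero_add, mul_zero] using this
  have h2 : σ w * x = 0 := by simpa [add_mul, h1] using hx
  have h3 : σ x * w = 0 := by rw [← hσ.invol w, ← hσ.map_mul, h2, hσ.map_zero]
  have h4 : σ x * b = 0 := by
    rw [← neg_neg b, ← h.map_b, mul_neg, ← hσ.map_mul, h1, hσ.map_zero, neg_zero]
  have h5 := h.mul_g (σ x) (by rw [mul_add, hw _ h3, h4, add_zero])
  rw [← hσ.invol x, ← hσ.map_mul, h5]

/-- If no obstruction is left then `1 - w` is a reflection. -/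
theorem exists_reflection [IsSemisimpleRing A] (h : IsMaximalSkew σ w f b g)
    (hσ : IsRingInvolution σ) (hw : w + σ w = σ w * w) (hg : g = 0) (h2 : IsUnit (2 : A)) :
    ∃ (y a : A) (hu : IsUnit (((h2.unit⁻¹ : Aˣ) : A) * (σ y * y) + a)),
      σ a = -a ∧ 1 - w = 1 - y * ((hu.unit⁻¹ : Aˣ) : A) * σ y := by
  have hc : IsUnit (σ w + b) := IsSemisimpleRing.isUnit_of_forall_mul_eq_zero fun x hx => by
    rw [← h.mul_g x hx, hg, mul_zero]
  have h22 : ((h2.unit⁻¹ : Aˣ) : A) * 2 = 1 := h2.val_inv_mul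
  set r := ((h2.unit⁻¹ : Aˣ) : A)
  have hσ2 : σ 2 = 2 := by rw [← one_add_one_eq_two, hσ.map_add, hσ.map_one]
  have h2c : ∀ x : A, 2 * x = x * 2 := fun x => by rw [two_mul, mul_two]
  have hrc : ∀ x : A, r * x = x * r := fun x => by
    have : r * (2 * x) * r = r * (x * 2) * r := by rw [h2c]
    have h2r : 2 * r = 1 := by rw [h2c, h22]
    rw [← mul_assoc, h22, one_mul, mul_assoc, mul_assoc, h2r, mul_one] at this
    exact this.symm
  have hσr : σ r = r := by
    have h3 : 2 * σ r = 1 := by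
      have := congrArg σ h22
      rwa [hσ.map_mul, hσ2, hσ.map_one] at this
    calc σ r = r * 2 * σ r := by rw [h22, one_mul]
      _ = r := by rw [mul_assoc, h3, mul_one]
  have hsum : r * (σ w * w) + (σ w + b - r * (σ w * w)) = σ w + b := by abel
  have hu : IsUnit (r * (σ w * w) + (σ w + b - r * (σ w * w))) := by rwa [hsum]
  refine ⟨w, σ w + b - r * (σ w * w), hu, ?_, ?_⟩
  · have hrr : r * (σ w * w) + r * (σ w * w) = w + σ w := by
      rw [← two_mul, ← mul_assoc, h2c, h22, one_mul, hw]
    rw [hσ.map_sub, hσ.map_add, hσ.invol, h.map_b, hσ.map_mul, hσ.map_mul, hσ.invol, hσr, ← hrc,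
      ← sub_eq_zero]
    calc _ = w + σ w - (r * (σ w * w) + r * (σ w * w)) := by abel
      _ = 0 := by rw [hrr, sub_self]
  · have h1 : ((hu.unit⁻¹ : Aˣ) : A) * σ w = 1 - σ f := by
      rw [Units.inv_mul_eq_iff_eq_mul, IsUnit.unit_spec, hsum, h.mul_one_sub hσ]
    rw [mul_assoc, h1, h.w_mul_one_sub hσ]

end IsMaximalSkew

end Ring

section Factor

variable {A : Type*} [Ring A] {R : Type*} [Ring R]

/-- `π` is the projection of `A` onto the direct factor cut out by the central idempotent `e`. -/
structure IsDirectFactor (π : A →+* R) (e : A) : Prop where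
  surjective : Function.Surjective π
  central : ∀ x, e * x = x * e
  idempotent : e * e = e
  map_eq_zero : ∀ x, π x = 0 ↔ e * x = 0

variable {σ : A → A} {π : A →+* R} {e : A}

namespace IsDirectFactor

theorem map_e (h : IsDirectFactor π e) : π e = 1 := by
  have : π (1 - e) = 0 := by rw [h.map_eq_zero, mul_sub, mul_one, h.idempotent, sub_self]
  rwa [map_sub, map_one, sub_eq_zero, eq_comm] at this

theorem comp {R' : Type*} [Ring R'] (h : IsDirectFactor π e) (φ : R ≃+* R') :
    IsDirectFactor ((φ : R →+* R').comp π) e where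
  surjective := φ.surjective.comp h.surjective
  central := h.central
  idempotent := h.idempotent
  map_eq_zero x := by simp [h.map_eq_zero]

theorem exists_involution (h : IsDirectFactor π e) (hσ : IsRingInvolution σ) (he : σ e = e) :
    ∃ τ : R → R, IsRingInvolution τ ∧ ∀ x, π (σ x) = τ (π x) := by
  have key : ∀ x, π (σ x) = π (σ (Function.surjInv h.surjective (π x))) := fun x => by
    set x' := Function.surjInv h.surjective (π x) with hx'
    have h1 : π (x - x') = 0 := by
      rw [map_sub, hx', Function.surjInv_eq h.surjective, sub_self]
    rw [h.map_eq_zero] at h1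
    have h2 : e * σ (x - x') = 0 := by
      have := congrArg σ h1
      rwa [hσ.map_mul, he, hσ.map_zero, ← h.central] at this
    rwa [← h.map_eq_zero, hσ.map_sub, map_sub, sub_eq_zero] at h2
  refine ⟨fun X => π (σ (Function.surjInv h.surjective X)), ⟨fun X Y => ?_, fun X Y => ?_,
    fun X => ?_⟩, key⟩
  · obtain ⟨x, rfl⟩ := h.surjective X
    obtain ⟨y, rfl⟩ := h.surjective Y
    rw [← map_add, ← key, ← key, ← key, hσ.map_add, map_add]
  · obtain ⟨x, rfl⟩ := h.surjective X
    obtain ⟨y, rfl⟩ := h.surjective Y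
    rw [← map_mul, ← key, ← key, ← key, hσ.map_mul, map_mul]
  · obtain ⟨x, rfl⟩ := h.surjective X
    rw [← key, hσ.invol, Function.surjInv_eq h.surjective]

theorem map_isMaximalSkew (h : IsDirectFactor π e) {τ : R → R} (hτ : ∀ x, π (σ x) = τ (π x))
    {w f b g : A} (hm : IsMaximalSkew σ w f b g) :
    IsMaximalSkew τ (π w) (π f) (π b) (π g) where
  f_mul_w := by rw [← map_mul, hm.f_mul_w, map_zero]
  f_mul_map_w := by rw [← hτ, ← map_mul, hm.f_mul_map_w, map_zero]
  f_mul_b := by rw [← map_mul, hm.f_mul_b]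
  map_b := by rw [← hτ, hm.map_b, map_neg]
  f_mul_g := by rw [← map_mul, hm.f_mul_g]
  g_mul_f := by rw [← map_mul, hm.g_mul_f]
  g_mul_b := by rw [← map_mul, hm.g_mul_b, map_zero]
  mul_g X hX := by
    obtain ⟨x, rfl⟩ := h.surjective X
    rw [← hτ, ← map_add, ← map_mul, h.map_eq_zero, ← mul_assoc] at hX
    have := congrArg π (hm.mul_g _ hX)
    simpa only [map_mul, h.map_e, one_mul] using this
  corner X := by
    obtain ⟨x, rfl⟩ := h.surjective X
    simp only [← hτ, ← map_mul, hm.corner x]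

end IsDirectFactor

/-- The factor `π` is stable under `σ`, and the induced involution has a nonzero symmetric
corner. -/
structure IsOrthogonalFactor (σ : A → A) (π : A →+* R) (e : A) : Prop extends
    IsDirectFactor π e where
  map_idempotent : σ e = e
  exists_corner : ∃ h, π h ≠ 0 ∧ ∀ x, π (h * x * σ h) = π (h * σ x * σ h)

theorem IsOrthogonalFactor.comp {R' : Type*} [Ring R'] (h : IsOrthogonalFactor σ π e)
    (φ : R ≃+* R') : IsOrthogonalFactor σ ((φ : R →+* R').comp π) e where
  toIsDirectFactor := h.toIsDirectFactor.comp φ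
  map_idempotent := h.map_idempotent
  exists_corner := by
    obtain ⟨y, hy, hyx⟩ := h.exists_corner
    exact ⟨y, by simpa using hy, fun x => congrArg φ (hyx x)⟩

theorem IsOrthogonalFactor.exists_involution (h : IsOrthogonalFactor σ π e)
    (hσ : IsRingInvolution σ) :
    ∃ τ : R → R, IsRingInvolution τ ∧ (∀ x, π (σ x) = τ (π x)) ∧
      ∃ y, y ≠ 0 ∧ IsSymmetricCorner τ y := by
  obtain ⟨τ, hτ, hπ⟩ := h.toIsDirectFactor.exists_involution hσ h.map_idempotent
  obtain ⟨y, hy, hyx⟩ := h.exists_corner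
  refine ⟨τ, hτ, hπ, π y, hy, fun X => ?_⟩
  obtain ⟨x, rfl⟩ := h.surjective X
  simpa only [← hπ, ← map_mul] using hyx x

/-- A matrix factor on which the obstruction `g` survives is orthogonal. -/
theorem IsDirectFactor.isOrthogonalFactor [IsSemisimpleRing A] {D : Type*} [DivisionRing D] {n : ℕ}
    {π : A →+* Matrix (Fin n) (Fin n) D} (h : IsDirectFactor π e) (hσ : IsRingInvolution σ)
    {w f b g : A} (hw : ∀ x, x * w = 0 → x * σ w = 0) (hm : IsMaximalSkew σ w f b g)
    (hg : π g ≠ 0) : IsOrthogonalFactor σ π e := by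
  have hcorner : ∀ x, π (g * x * σ g) = π (g * σ x * σ g) := fun x => by rw [hm.corner x]
  refine ⟨h, ?_, g, hg, hcorner⟩
  have hg' : π (σ g) ≠ 0 := fun h0 => by
    rw [h.map_eq_zero] at h0
    have hunit : IsUnit (σ ((σ w + b) * e + (1 - e))) := by
      refine IsSemisimpleRing.isUnit_of_forall_mul_eq_zero fun x hx => ?_
      have h1 : ((σ w + b) * e + (1 - e)) * σ x = 0 := by
        rw [← hσ.invol ((σ w + b) * e + (1 - e)), ← hσ.map_mul, hx, hσ.map_zero]
      have h2 : (σ w + b) * (e * σ x) = 0 := by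
        have := congrArg (e * ·) h1
        simp only [mul_zero] at this
        rwa [← mul_assoc, mul_add, mul_sub, mul_one, h.idempotent, sub_self, add_zero, h.central,
          mul_assoc _ e e, h.idempotent, mul_assoc] at this
      have h3 : (1 - e) * σ x = 0 := by
        rwa [add_mul, mul_assoc, h2, zero_add] at h1
      rw [sub_mul, one_mul, sub_eq_zero] at h3
      have h4 := hm.map_g_mul_of_mul_eq_zero hσ hw h2
      rw [← mul_assoc, ← h.central, h0, zero_mul, ← h3] at h4
      exact hσ.map_eq_zero.1 h4.symm
    have h5 : σ ((σ w + b) * e + (1 - e)) * σ (g * e) = 0 := by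
      rw [← hσ.map_mul, hσ.map_eq_zero, mul_add, mul_assoc g e, ← mul_assoc e, h.central,
        mul_assoc _ e e, h.idempotent, ← mul_assoc, mul_add g, hm.g_mul_map_w, hm.g_mul_b, add_zero,
        zero_mul, zero_add, mul_assoc, mul_sub, mul_one, h.idempotent, sub_self, mul_zero]
    have h6 := hσ.map_eq_zero.1 (hunit.mul_right_eq_zero.1 h5)
    exact hg ((h.map_eq_zero g).2 (by rw [h.central, h6]))
  obtain ⟨T, hT⟩ := Matrix.exists_mul_mul_ne_zero hg hg'
  obtain ⟨t, rfl⟩ := h.surjective T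
  have hp : g * (e * t) * σ g = g * (e * t) * σ g * σ e := by
    have h1 : g * (e * t) * σ g = e * (g * (e * t) * σ g) := by
      simp only [← mul_assoc]
      rw [h.central g, mul_assoc g e e, h.idempotent]
    conv_lhs => rw [← hm.corner.map_eq hσ, h1, hσ.map_mul, hm.corner.map_eq hσ]
  have hq0 : π (σ e) ≠ 0 := fun h0 => by
    have := congrArg π hp
    rw [map_mul _ _ (σ e), h0, mul_zero] at this
    simp only [map_mul, h.map_e, one_mul] at this
    exact hT this
  have hσe : ∀ x, σ e * x = x * σ e := fun x => by
    rw [← hσ.invol x, ← hσ.map_mul, ← h.central, hσ.map_mul]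
  have hσee : σ e * σ e = σ e := by rw [← hσ.map_mul, h.idempotent]
  have hq1 : π (1 - σ e) = 0 := by
    by_contra hne
    obtain ⟨T, hT⟩ := Matrix.exists_mul_mul_ne_zero hq0 hne
    obtain ⟨t, rfl⟩ := h.surjective T
    apply hT
    rw [← map_mul, ← map_mul, hσe, mul_assoc, mul_sub, mul_one, hσee, sub_self, mul_zero, map_zero]
  rw [h.map_eq_zero, mul_sub, mul_one, sub_eq_zero] at hq1
  rw [hq1, hσ.map_mul, hσ.invol]

theorem DivisionRing.exists_field_ringEquiv {D : Type v} [inst : DivisionRing D]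
    (h : ∀ a b : D, a * b = b * a) : ∃ (k : Type v) (_ : Field k), Nonempty (D ≃+* k) := by
  let F : Field D := { inst with mul_comm := h }
  exact ⟨D, F, ⟨RingEquiv.refl D⟩⟩

theorem IsOrthogonalFactor.exists_field {D : Type v} [DivisionRing D] {n : ℕ}
    {π : A →+* Matrix (Fin n) (Fin n) D} (h : IsOrthogonalFactor σ π e) (hσ : IsRingInvolution σ) :
    ∃ (k : Type v) (_ : Field k), Nonempty (D ≃+* k) := by
  obtain ⟨τ, hτ, -, y, hy0, hy⟩ := h.exists_involution hσ
  exact DivisionRing.exists_field_ringEquiv (hy.commute hτ hy0)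

/-- The determinant of `1 - w` on a factor where the obstruction `g` survives. -/
theorem IsMaximalSkew.det_one_sub {k : Type*} [Field k] {n : ℕ}
    {τ : Matrix (Fin n) (Fin n) k → Matrix (Fin n) (Fin n) k} (hτ : IsRingInvolution τ)
    {w f b g : Matrix (Fin n) (Fin n) k} (h : IsMaximalSkew τ w f b g) (hw : w + τ w = τ w * w)
    (hg : g ≠ 0) : (1 - w).det = -(-1) ^ n := by
  obtain ⟨S, hSt, hS, hτS⟩ := h.corner.exists_form hτ hg
  have hrank := h.corner.mul_apply_eq hSt hS hτS
  obtain ⟨t, ht⟩ := Matrix.exists_mul_mul_ne_zero hg (mt hτ.map_eq_zero.1 hg)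
  have hpsym := h.corner.map_eq hτ t
  have hgp : g * (g * t * τ g) = g * t * τ g := by
    rw [← Matrix.mul_assoc, ← Matrix.mul_assoc, h.g_mul_self]
  have hpg : g * t * τ g * τ g = g * t * τ g := by
    rw [Matrix.mul_assoc, ← hτ.map_mul, h.g_mul_self]
  have hpf : g * t * τ g * τ f = g * t * τ g := by
    rw [Matrix.mul_assoc, ← hτ.map_mul, h.f_mul_g]
  set p := g * t * τ g
  have hwg : τ w * τ g = 0 := by rw [← hτ.map_mul, h.g_mul_w, hτ.map_zero]
  have hbg : b * τ g = 0 := by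
    rw [← neg_inj, ← neg_mul, ← h.map_b, ← hτ.map_mul, h.g_mul_b, hτ.map_zero, neg_zero]
  have hunit : IsUnit (τ w + b + p) := by
    refine IsSemisimpleRing.isUnit_of_forall_mul_eq_zero fun x hx => ?_
    have hxp : x * p = 0 := by
      have := congrArg (· * τ g) hx
      simpa only [Matrix.mul_assoc, Matrix.add_mul, hwg, hbg, hpg, zero_add,
        Matrix.zero_mul] using this
    have hxg : x * g = x := h.mul_g x (by rwa [Matrix.mul_add, hxp, add_zero] at hx)
    obtain ⟨r, m, hrm⟩ : ∃ r m, p r m ≠ 0 := by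
      by_contra! h
      exact ht (Matrix.ext h)
    ext l c
    have h1 : ∀ a, x l a * g r c = x l c * g r a := fun a => by
      rw [← hxg]
      simp only [Matrix.mul_apply, Finset.sum_mul, mul_assoc]
      exact Finset.sum_congr rfl fun i _ => by rw [hrank i r a c]
    have h2 : (x * p) l m * g r c = x l c * (g * p) r m := by
      simp only [Matrix.mul_apply, Finset.sum_mul, Finset.mul_sum]
      exact Finset.sum_congr rfl fun a _ => by linear_combination p a m * h1 a
    rw [hxp, hgp, Matrix.zero_apply, zero_mul] at h2
    exact (mul_eq_zero.1 h2.symm).resolve_right hrm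
  have hcf : (τ w + b + p) * (1 - τ f) = τ w := by
    rw [Matrix.add_mul, h.mul_one_sub hτ, Matrix.mul_sub, Matrix.mul_one, hpf, sub_self, add_zero]
  have hdet1 : (1 - (1 - τ f) * w).det = (1 - w).det := by
    rw [Matrix.det_one_sub_mul_comm, h.w_mul_one_sub hτ]
  have hgc : g * (w + -b + p) = p := by
    rw [Matrix.mul_add, Matrix.mul_add, h.g_mul_w, Matrix.mul_neg, h.g_mul_b, hgp, neg_zero,
      add_zero, zero_add]
  have hprod : (τ w + b + p) * (1 - (1 - τ f) * w) = -((1 - 2 * g) * τ (τ w + b + p)) := by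
    rw [Matrix.mul_sub, Matrix.mul_one, ← Matrix.mul_assoc, hcf, ← hw, hτ.map_add, hτ.map_add,
      hτ.invol, h.map_b, hpsym, Matrix.sub_mul, Matrix.one_mul, Matrix.mul_assoc, hgc, two_mul]
    abel
  have hdet := congrArg Matrix.det hprod
  rw [Matrix.det_mul, hdet1, Matrix.det_neg, Matrix.det_mul, Fintype.card_fin,
    Matrix.det_map_of_form hS hτS, Matrix.det_one_sub_two_mul_of_rank_one h.g_mul_self hg hrank]
    at hdet
  refine ((Matrix.isUnit_iff_isUnit_det _).1 hunit).mul_left_cancel ?_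
  rw [hdet]
  ring

end Factor

theorem IsOrthogonalFactor.det_eq_one {A : Type v} [Ring A] {σ : A → A} (hσ : IsRingInvolution σ)
    {k : Type v} [Field k] {n : ℕ} {π : A →+* Matrix (Fin n) (Fin n) k} {e : A}
    (h : IsOrthogonalFactor σ π e) {u : A} (hu : U0Mem σ u) : (π u).det = 1 := by
  obtain ⟨τ, hτ, hπ, y, hy0, hy⟩ := h.exists_involution hσ
  obtain ⟨S, hSt, hS, hτS⟩ := hy.exists_form hτ hy0
  exact hu.2 n k π τ h.surjective hπ hτ.map_add hτ.map_mul hτ.invol (hy.map_smul_one hτ hy0)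
    (Matrix.finrank_span_symmetric_of_form hSt hS hτS)

section Product

variable {A : Type v} [Ring A] {m : ℕ} {D : Fin m → Type v} [∀ i, DivisionRing (D i)]
  {d : Fin m → ℕ}

/-- The projection onto a factor of a product of matrix rings. -/
def matrixFactor (Φ : A ≃+* Π i, Matrix (Fin (d i)) (Fin (d i)) (D i)) (i : Fin m) :
    A →+* Matrix (Fin (d i)) (Fin (d i)) (D i) :=
  (Pi.evalRingHom _ i).comp (Φ : A →+* Π i, Matrix (Fin (d i)) (Fin (d i)) (D i))

/-- The central idempotent of a factor of a product of matrix rings. -/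
def factorIdempotent (Φ : A ≃+* Π i, Matrix (Fin (d i)) (Fin (d i)) (D i)) (i : Fin m) : A :=
  Φ.symm (Pi.single i 1)

variable (Φ : A ≃+* Π i, Matrix (Fin (d i)) (Fin (d i)) (D i))

theorem isDirectFactor_matrixFactor (i : Fin m) :
    IsDirectFactor (matrixFactor Φ i) (factorIdempotent Φ i) := by
  have hmul : ∀ x, Φ (factorIdempotent Φ i * x) = Pi.single i (Φ x i) := fun x => by
    rw [map_mul, factorIdempotent, RingEquiv.apply_symm_apply, ← Pi.single_mul_left, one_mul]
  have hmul' : ∀ x, Φ (x * factorIdempotent Φ i) = Pi.single i (Φ x i) := fun x => by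
    rw [map_mul, factorIdempotent, RingEquiv.apply_symm_apply, ← Pi.single_mul_right, mul_one]
  refine ⟨fun X => ⟨Φ.symm (Pi.single i X), ?_⟩, fun x => Φ.injective ?_, Φ.injective ?_,
    fun x => ?_⟩
  · simp [matrixFactor]
  · rw [hmul, hmul']
  · rw [hmul, factorIdempotent, RingEquiv.apply_symm_apply, Pi.single_eq_same]
  · rw [← map_eq_zero_iff Φ Φ.injective, hmul, Pi.single_eq_zero_iff]
    rfl

theorem matrixFactor_factorIdempotent (i j : Fin m) :
    matrixFactor Φ i (factorIdempotent Φ j) = if i = j then 1 else 0 := by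
  split_ifs with hij
  · subst hij
    exact (isDirectFactor_matrixFactor Φ i).map_e
  · have : Φ (factorIdempotent Φ j) i = 0 := by
      rw [factorIdempotent, RingEquiv.apply_symm_apply, Pi.single_eq_of_ne hij]
    exact this

variable {Φ} {σ : A → A}

/-- A unitary element whose determinant on each orthogonal factor of degree `d` is `(-1) ^ d` is a
reflection. -/
theorem IsRingInvolution.exists_reflection [IsSemisimpleRing A] (hσ : IsRingInvolution σ)
    (h2 : IsUnit (2 : A)) {u : A} (hu : σ u * u = 1) (hu' : u * σ u = 1)
    (hdet : ∀ i, IsOrthogonalFactor σ (matrixFactor Φ i) (factorIdempotent Φ i) →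
      ∀ (k : Type v) [Field k] (φ : D i ≃+* k),
        (φ.mapMatrix (matrixFactor Φ i u)).det = (-1) ^ d i) :
    ∃ (y a : A) (h : IsUnit (((h2.unit⁻¹ : Aˣ) : A) * (σ y * y) + a)),
      σ a = -a ∧ u = 1 - y * ((h.unit⁻¹ : Aˣ) : A) * σ y := by
  obtain ⟨w, rfl⟩ : ∃ w, u = 1 - w := ⟨1 - u, by abel⟩
  have hσw : σ (1 - w) = 1 - σ w := by rw [hσ.map_sub, hσ.map_one]
  rw [hσw] at hu hu'
  have hw : w + σ w = σ w * w := by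
    have : (1 - σ w) * (1 - w) = 1 - (w + σ w - σ w * w) := by noncomm_ring
    rw [this, sub_eq_self, sub_eq_zero] at hu
    exact hu
  have hw' : w + σ w = w * σ w := by
    have : (1 - w) * (1 - σ w) = 1 - (w + σ w - w * σ w) := by noncomm_ring
    rw [this, sub_eq_self, sub_eq_zero] at hu'
    exact hu'
  have hann : ∀ x, x * w = 0 → x * σ w = 0 := fun x hx => by
    have := congrArg (x * ·) hw'
    simpa only [mul_add, ← mul_assoc, hx, zero_add, zero_mul] using this
  have hann' : ∀ x, x * σ w = 0 → x * w = 0 := fun x hx => by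
    have := congrArg (x * ·) hw
    simpa only [mul_add, ← mul_assoc, hx, add_zero, zero_mul] using this
  obtain ⟨f, b, g, hm⟩ := hσ.exists_isMaximalSkew hann hann'
  refine hm.exists_reflection hσ hw ?_ h2
  by_contra hg
  obtain ⟨i, hi⟩ : ∃ i, matrixFactor Φ i g ≠ 0 := by
    by_contra! h
    exact hg ((map_eq_zero_iff Φ Φ.injective).1 (funext h))
  have horth := (isDirectFactor_matrixFactor Φ i).isOrthogonalFactor hσ hann hm hi
  obtain ⟨k, _, ⟨φ⟩⟩ := horth.exists_field hσ
  have horth' := horth.comp φ.mapMatrix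
  obtain ⟨τ, hτ, hπ⟩ := horth'.toIsDirectFactor.exists_involution hσ horth'.map_idempotent
  set π := ((φ.mapMatrix : _ ≃+* Matrix (Fin (d i)) (Fin (d i)) k) :
    _ →+* Matrix (Fin (d i)) (Fin (d i)) k).comp (matrixFactor Φ i) with hπdef
  have hπg : π g ≠ 0 := fun h => hi ((map_eq_zero_iff _ φ.mapMatrix.injective).1 h)
  have h1 := (horth'.toIsDirectFactor.map_isMaximalSkew hπ hm).det_one_sub hτ
    (by rw [← hπ, ← map_mul, ← map_add, hw]) hπg
  have h3 : (π (1 - w)).det = (-1) ^ d i := hdet i horth k φ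
  rw [map_sub, map_one, h1, neg_eq_iff_add_eq_zero, ← two_mul] at h3
  have h4 : (2 : k) = 0 := (mul_eq_zero.1 h3).resolve_right (pow_ne_zero _ (by simp))
  have h5 : π 2 = 0 := by
    rw [map_ofNat]
    ext p q
    rw [Matrix.ofNat_apply]
    simp [h4]
  have h6 : IsUnit (π 2) := h2.map π
  rw [h5, isUnit_zero_iff] at h6
  exact hπg (by rw [← mul_one (π g), ← h6, mul_zero])

end Product

/-- **Theorem.** Let `(A,σ)` be a semisimple artinian ring with involution such that `2 ∈ Aˣ`.
Then the subgroup of `U(A,σ)` generated by the `1`-reflections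
`s_{y,a} = 1 - y(½ σ(y)y + a)⁻¹ σ(y)` (for `y ∈ A`, `a ∈ Sym₋₁(A,σ)` with
`½ σ(y)y + a ∈ Aˣ`) contains `U⁰(A,σ)`. -/
theorem U0_le_subgroup_generated_by_reflections
    (A : Type v) [Ring A] (hA : IsSemisimpleRing A)
    (h2 : IsUnit (2 : A))
    (σ : A → A)
    (hadd : ∀ x y : A, σ (x + y) = σ x + σ y)
    (hmul : ∀ x y : A, σ (x * y) = σ y * σ x)
    (hinv : ∀ x : A, σ (σ x) = x)
    (u : A) (hu : U0Mem σ u) :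
    ∃ s ∈ Subgroup.closure
        {s : Aˣ | ∃ (y a : A)
          (h : IsUnit (((h2.unit⁻¹ : Aˣ) : A) * (σ y * y) + a)),
          σ a = -a ∧ (s : A) = 1 - y * ((h.unit⁻¹ : Aˣ) : A) * σ y},
      (s : A) = u := by
  have hσ : IsRingInvolution σ := ⟨hadd, hmul, hinv⟩
  obtain ⟨m, D, d, _, -, ⟨Φ⟩⟩ := IsSemisimpleRing.exists_ringEquiv_pi_matrix_divisionRing A
  classical
  let Q : Fin m → Prop := fun i => IsOrthogonalFactor σ (matrixFactor Φ i) (factorIdempotent Φ i)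
  let J : Finset (Fin m) := Finset.univ.filter fun i => Q i ∧ Odd (d i)
  let z : A := ∑ j ∈ J, factorIdempotent Φ j
  have hπz : ∀ i, matrixFactor Φ i z = if i ∈ J then 1 else 0 := fun i => by
    simp only [z, map_sum, matrixFactor_factorIdempotent, Finset.sum_ite_eq]
  have hext : ∀ x y : A, (∀ i, matrixFactor Φ i x = matrixFactor Φ i y) → x = y :=
    fun x y h => Φ.injective (funext h)
  have hzz : z * z = z := hext _ _ fun i => by
    rw [map_mul, hπz]
    split_ifs <;> simp
  have hσz : σ z = z := by
    let σ' : A →+ A := ⟨⟨σ, hσ.map_zero⟩, hσ.map_add⟩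
    change σ' z = z
    rw [map_sum]
    exact Finset.sum_congr rfl fun j hj => (Finset.mem_filter.1 hj).2.1.map_idempotent
  obtain ⟨ε, hε⟩ : ∃ ε, ε = 1 - (z + z) := ⟨_, rfl⟩
  have hσε : σ ε = ε := by rw [hε, hσ.map_sub, hσ.map_one, hσ.map_add, hσz]
  have hεε : ε * ε = 1 := by
    have : ε * ε = 1 - 4 * z + 4 * (z * z) := by rw [hε]; noncomm_ring
    rw [this, hzz, sub_add_cancel]
  have hπε : ∀ i, Q i → matrixFactor Φ i ε = (-1) ^ d i := fun i hi => by
    rw [hε, map_sub, map_one, map_add, hπz]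
    rcases Nat.even_or_odd (d i) with h | h
    · rw [if_neg fun hJ => Nat.not_even_iff_odd.2 (Finset.mem_filter.1 hJ).2.2 h, h.neg_one_pow]
      simp
    · rw [if_pos (Finset.mem_filter.2 ⟨Finset.mem_univ i, hi, h⟩), h.neg_one_pow]
      abel
  have hpow : ∀ n : ℕ, ((-1 : ℤ) ^ n) ^ n = (-1) ^ n := fun n => by
    rw [← pow_mul]
    rcases Nat.even_or_odd n with h | h
    · rw [h.neg_one_pow, (h.mul_right n).neg_one_pow]
    · rw [h.neg_one_pow, (h.mul h).neg_one_pow]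
  have hdetε : ∀ i, Q i → ∀ (k : Type v) [Field k] (φ : D i ≃+* k),
      (φ.mapMatrix (matrixFactor Φ i ε)).det = (-1) ^ d i := fun i hi k _ φ => by
    rw [hπε i hi, map_pow, map_neg, map_one, Matrix.det_pow, Matrix.det_neg, Matrix.det_one,
      mul_one, Fintype.card_fin]
    exact_mod_cast congrArg (Int.cast : ℤ → k) (hpow (d i))
  have huu : u * σ u = 1 := mul_eq_one_symm hu.1
  have hεu : ∀ i, Q i → ∀ (k : Type v) [Field k] (φ : D i ≃+* k),
      (φ.mapMatrix (matrixFactor Φ i (ε * u))).det = (-1) ^ d i := fun i hi k _ φ => by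
    have h1 : (φ.mapMatrix (matrixFactor Φ i u)).det = 1 := (hi.comp φ.mapMatrix).det_eq_one hσ hu
    rw [map_mul, map_mul, Matrix.det_mul, h1, hdetε i hi, mul_one]
  obtain ⟨y₁, a₁, h₁, ha₁, hs₁⟩ := hσ.exists_reflection h2 (by rw [hσε, hεε]) (by rw [hσε, hεε])
    hdetε
  obtain ⟨y₂, a₂, h₂, ha₂, hs₂⟩ := hσ.exists_reflection (u := ε * u) h2
    (by rw [hσ.map_mul, hσε, mul_assoc, ← mul_assoc ε, hεε, one_mul, hu.1])
    (by rw [hσ.map_mul, hσε, mul_assoc, ← mul_assoc u, huu, one_mul, hεε]) hεu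
  let s₁ : Aˣ := ⟨ε, ε, hεε, hεε⟩
  let s₂ : Aˣ := ⟨ε * u, σ u * ε, by rw [mul_assoc, ← mul_assoc u, huu, one_mul, hεε],
    by rw [mul_assoc, ← mul_assoc ε, hεε, one_mul, hu.1]⟩
  refine ⟨s₁ * s₂, mul_mem (Subgroup.subset_closure ⟨y₁, a₁, h₁, ha₁, hs₁⟩)
    (Subgroup.subset_closure ⟨y₂, a₂, h₂, ha₂, hs₂⟩), ?_⟩
  change ε * (ε * u) = u
  rw [← mul_assoc, hεε, one_mul]
end

section
/- Let (A,σ) be a semilocal ring with involution such that 2 ∈ A^×. Write Ā = A/Jac(A), let a ↦ ā denote the quotient map, and let σ̄ : Ā → Ā be the induced involution ā^σ̄ = (a^σ)‾. Then the image of the map u ↦ ū : U(A,σ) → U(Ā,σ̄) contains the subgroup U^0(Ā,σ̄). -/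
universe u v

theorem Matrix.eq_zero_or_eq_zero_of_forall_mul_mul_eq_zero {n : ℕ} {D : Type*} [DivisionRing D]
    {X Y : Matrix (Fin n) (Fin n) D} (h : ∀ M : Matrix (Fin n) (Fin n) D, X * M * Y = 0) :
    X = 0 ∨ Y = 0 := by
  by_contra! hXY
  obtain ⟨i, j, hX⟩ : ∃ i j, X i j ≠ 0 := by
    by_contra! h0
    exact hXY.1 (Matrix.ext h0)
  obtain ⟨k, l, hY⟩ : ∃ k l, Y k l ≠ 0 := by
    by_contra! h0
    exact hXY.2 (Matrix.ext h0)
  have key := congrFun (congrFun (h (Matrix.single j k 1)) i) l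
  rw [Matrix.mul_apply, Finset.sum_eq_single k] at key
  · simp [hX, hY] at key
  · intro m _ hm
    rw [Matrix.mul_single_apply_of_ne (hbj := hm), zero_mul]
  · simp

theorem Matrix.vecMulVec_mul_vecMulVec_of_dotProduct_eq_one {n : ℕ} {D : Type*} [DivisionRing D]
    (ξ η : Fin n → D) (h : η ⬝ᵥ ξ = 1) (x y : Fin n → D) :
    Matrix.vecMulVec x η * Matrix.vecMulVec ξ y = Matrix.vecMulVec x y := by
  rw [Matrix.vecMulVec_mul_vecMulVec, h]
  simp

/-- An idempotent matrix with commutative corner ring has rank one, and the division ring of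
entries is commutative. -/
theorem Matrix.rank_one_of_commutative_corner {n : ℕ} {D : Type*} [DivisionRing D]
    {p : Matrix (Fin n) (Fin n) D} (hp : p * p = p) (hp0 : p ≠ 0)
    (hcomm : ∀ x y, (p * x * p) * (p * y * p) = (p * y * p) * (p * x * p)) :
    (∀ a b : D, a * b = b * a) ∧
      ∃ ξ η : Fin n → D, p = Matrix.vecMulVec ξ η ∧ η ⬝ᵥ ξ = 1 := by
  obtain ⟨i, j, hij⟩ : ∃ i j, p i j ≠ 0 := by
    by_contra! h0
    exact hp0 (Matrix.ext h0)
  set ξ : Fin n → D := fun l => p l j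
  set η : Fin n → D := fun l => (p i j)⁻¹ * p i l
  have hηξ : η ⬝ᵥ ξ = 1 := by
    have h1 := congrFun (congrFun hp i) j
    rw [Matrix.mul_apply] at h1
    simp only [η, ξ, dotProduct, mul_assoc, ← Finset.mul_sum, h1]
    exact inv_mul_cancel₀ hij
  have hpξ (y : Fin n → D) : p * Matrix.vecMulVec ξ y = Matrix.vecMulVec ξ y := by
    rw [Matrix.mul_vecMulVec]
    congr 1
    funext l
    exact congrFun (congrFun hp l) j
  have hηp (x : Fin n → D) : Matrix.vecMulVec x η * p = Matrix.vecMulVec x η := by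
    rw [Matrix.vecMulVec_mul]
    congr 1
    funext l
    have h1 := congrFun (congrFun hp i) l
    rw [Matrix.mul_apply] at h1
    simp only [η, Matrix.vecMul, dotProduct, mul_assoc, ← Finset.mul_sum, h1]
  have hcorner (x y : Matrix (Fin n) (Fin n) D) (hx : p * x * p = x) (hy : p * y * p = y) :
      x * y = y * x := by
    have := hcomm x y
    rwa [hx, hy] at this
  refine ⟨fun a b => ?_, ξ, η, ?_, hηξ⟩
  · let S (a : D) : Matrix (Fin n) (Fin n) D :=
      Matrix.vecMulVec ξ (fun l => a * η l)
    have hS (a : D) : p * S a * p = S a := by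
      rw [hpξ, Matrix.vecMulVec_mul]
      congr 1
      funext l
      have h1 := congrFun (congrFun hp i) l
      rw [Matrix.mul_apply] at h1
      simp only [η, Matrix.vecMul, dotProduct, mul_assoc, ← Finset.mul_sum, h1]
    have hSm (a b : D) : S a * S b = S (a * b) := by
      simp only [S]
      have : (fun l => a * η l) ⬝ᵥ ξ = a := by
        have h2 := congrArg (a * ·) hηξ
        simpa only [dotProduct, Finset.mul_sum, mul_assoc, mul_one] using h2
      rw [Matrix.vecMulVec_mul_vecMulVec, this]
      congr 1
      funext l
      simp [mul_assoc]
    have h1 := hcorner (S a) (S b) (hS a) (hS b)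
    rw [hSm, hSm] at h1
    have h2 := congrFun (congrFun h1 i) j
    simp only [S, Matrix.vecMulVec_apply, η, ξ, inv_mul_cancel₀ hij, mul_one] at h2
    exact mul_left_cancel₀ hij h2
  · set q := Matrix.vecMulVec ξ η
    have hqq : q * q = q := Matrix.vecMulVec_mul_vecMulVec_of_dotProduct_eq_one ξ η hηξ ξ η
    have hpq : p * q = q := hpξ η
    have hqp : q * p = q := hηp ξ
    have hz : ∀ m, (p - q) * m * q = 0 := by
      intro m
      have h1 := hcorner (p * m * p) q (by simp only [mul_assoc, hp]; simp only [← mul_assoc, hp])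
        (by rw [hpq, hqp])
      have h2 : (p - q) * (p * m * p) * q = 0 := by
        rw [mul_assoc, h1, ← mul_assoc, sub_mul, hpq, hqq, sub_self, zero_mul]
      have h3 : (p - q) * p = p - q := by rw [sub_mul, hp, hqp]
      calc (p - q) * m * q = ((p - q) * p) * m * (p * q) := by rw [h3, hpq]
        _ = (p - q) * (p * m * p) * q := by simp only [mul_assoc]
        _ = 0 := h2
    rcases Matrix.eq_zero_or_eq_zero_of_forall_mul_mul_eq_zero hz with h | h
    · exact sub_eq_zero.1 h
    · exfalso
      have := congrFun (congrFun h i) j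
      simp [q, Matrix.vecMulVec_apply, ξ, η, hij] at this

/-- An involution of the first kind on a split central simple algebra is adjoint to a bilinear
form. -/
theorem Matrix.exists_eq_mul_transpose_mul {n : ℕ} {k : Type*} [Field k]
    (τ : Matrix (Fin n) (Fin n) k → Matrix (Fin n) (Fin n) k)
    (hadd : ∀ X Y, τ (X + Y) = τ X + τ Y) (hmul : ∀ X Y, τ (X * Y) = τ Y * τ X)
    (hinv : ∀ X, τ (τ X) = X)
    (hscal : ∀ c : k, τ (c • (1 : Matrix (Fin n) (Fin n) k)) = c • 1) :
    ∃ G H : Matrix (Fin n) (Fin n) k, G * H = 1 ∧ H * G = 1 ∧ ∀ X, τ X = H * X.transpose * G := by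
  let e : Matrix (Fin n) (Fin n) k ≃ₐ[k] Matrix (Fin n) (Fin n) k :=
    { toFun := fun X => τ X.transpose
      invFun := fun X => (τ X).transpose
      left_inv := fun X => by simp [hinv]
      right_inv := fun X => by simp [hinv]
      map_mul' := fun X Y => by simp [Matrix.transpose_mul, hmul]
      map_add' := fun X Y => by simp [hadd]
      commutes' := fun c => by
        rw [Algebra.algebraMap_eq_smul_one, Matrix.transpose_smul, Matrix.transpose_one, hscal] }
  let L : Matrix (Fin n) (Fin n) k ≃ₐ[k] ((Fin n → k) →ₗ[k] (Fin n → k)) := Matrix.toLinAlgEquiv'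
  obtain ⟨T, hT⟩ := ((L.symm.trans e).trans L).eq_linearEquivConjAlgEquiv
  refine ⟨L.symm T.symm.toLinearMap, L.symm T.toLinearMap, ?_, ?_, fun X => ?_⟩
  · rw [← map_mul, ← map_one L.symm]
    congr 1
    ext x : 2
    simp
  · rw [← map_mul, ← map_one L.symm]
    congr 1
    ext x : 2
    simp
  · apply L.injective
    have h1 := congrArg (fun F => F (L X.transpose)) hT
    simp only [AlgEquiv.trans_apply, AlgEquiv.symm_apply_apply] at h1
    have h2 : e X.transpose = τ X := by simp [e]
    rw [h2] at h1
    rw [h1, map_mul, map_mul, AlgEquiv.apply_symm_apply, AlgEquiv.apply_symm_apply]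
    rfl

theorem Matrix.finrank_span_isSymm {n : ℕ} {k : Type*} [Field k] :
    2 * Module.finrank k (Submodule.span k {X : Matrix (Fin n) (Fin n) k | X.IsSymm}) =
      n * (n + 1) := by
  let F : (Sym2 (Fin n) → k) →ₗ[k] Matrix (Fin n) (Fin n) k :=
    { toFun := fun f => Matrix.of fun i j => f s(i, j)
      map_add' := fun f g => by ext; simp
      map_smul' := fun c f => by ext; simp }
  have hF : Function.Injective F := by
    intro f g h
    funext x
    induction x with
    | h i j => exact congrFun (congrFun h i) j
  have hr : Submodule.span k {X : Matrix (Fin n) (Fin n) k | X.IsSymm} = LinearMap.range F := by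
    apply le_antisymm
    · rw [Submodule.span_le]
      intro X hX
      refine ⟨Sym2.lift ⟨fun i j => X i j, fun i j => hX.apply j i⟩, ?_⟩
      ext i j
      simp [F]
    · rintro _ ⟨f, rfl⟩
      apply Submodule.subset_span
      ext i j
      simp [F, Sym2.eq_swap]
  rw [hr, LinearMap.finrank_range_of_inj hF, Module.finrank_fintype_fun_eq_card, Sym2.card,
    Fintype.card_fin, Nat.choose_two_right, Nat.mul_div_cancel' (Nat.even_mul_pred_self _).two_dvd]
  simp [mul_comm]

/-- A first-kind involution on a matrix algebra with a nonzero symmetric element of rank one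
is orthogonal, and it preserves determinants. -/
theorem Matrix.orthogonal_of_symm_rank_one {n : ℕ} {k : Type*} [Field k]
    (τ : Matrix (Fin n) (Fin n) k → Matrix (Fin n) (Fin n) k)
    (hadd : ∀ X Y, τ (X + Y) = τ X + τ Y) (hmul : ∀ X Y, τ (X * Y) = τ Y * τ X)
    (hinv : ∀ X, τ (τ X) = X)
    (hscal : ∀ c : k, τ (c • (1 : Matrix (Fin n) (Fin n) k)) = c • 1)
    (ζ η : Fin n → k) (hz0 : Matrix.vecMulVec ζ η ≠ 0)
    (hz : τ (Matrix.vecMulVec ζ η) = Matrix.vecMulVec ζ η) :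
    2 * Module.finrank k (Submodule.span k {X | τ X = X}) = n * (n + 1) ∧
      ∀ X, (τ X).det = X.det := by
  obtain ⟨G, H, hGH, hHG, hτ⟩ := Matrix.exists_eq_mul_transpose_mul τ hadd hmul hinv hscal
  have hGHt : H.transpose * G.transpose = 1 := by
    rw [← Matrix.transpose_mul, hGH, Matrix.transpose_one]
  obtain ⟨l, hl⟩ : ∃ l : k, G.transpose = l • G := by
    have hc : ∀ X, H * G.transpose * X = X * (H * G.transpose) := by
      intro X
      have h1 := hinv X
      rw [hτ, hτ, Matrix.transpose_mul, Matrix.transpose_mul, Matrix.transpose_transpose] at h1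
      calc H * G.transpose * X = H * G.transpose * X * ((H.transpose * G * H) * G.transpose) := by
            rw [mul_assoc _ G H, hGH, mul_one, hGHt, mul_one]
        _ = (H * (G.transpose * (X * H.transpose)) * G) * (H * G.transpose) := by
            simp only [mul_assoc]
        _ = X * (H * G.transpose) := by rw [h1]
    obtain ⟨l, hl⟩ : H * G.transpose ∈ Set.range (Matrix.scalar (Fin n)) :=
      Matrix.mem_range_scalar_iff_commute_single'.2 fun i j => (hc _).symm
    refine ⟨l, ?_⟩
    calc G.transpose = G * (H * G.transpose) := by rw [← mul_assoc, hGH, one_mul]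
      _ = l • G := by rw [← hl, Matrix.scalar_apply, Matrix.smul_eq_mul_diagonal]
  have hGz : (Matrix.vecMulVec ζ η).transpose * G = G * Matrix.vecMulVec ζ η := by
    conv_rhs => rw [← hz, hτ, mul_assoc H, ← mul_assoc, hGH, one_mul]
  have hS : (Matrix.vecMulVec (G.mulVec ζ) η).transpose = l • Matrix.vecMulVec (G.mulVec ζ) η := by
    rw [← Matrix.mul_vecMulVec, Matrix.transpose_mul, hl, Matrix.mul_smul, hGz]
  have hSij (i j : Fin n) : (G.mulVec ζ) j * η i = l * ((G.mulVec ζ) i * η j) :=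
    congrFun (congrFun hS i) j
  have hl1 : l = 1 := by
    obtain ⟨i, j, hij⟩ : ∃ i j, (G.mulVec ζ) i * η j ≠ 0 := by
      by_contra! h0
      apply hz0
      have : G * Matrix.vecMulVec ζ η = 0 := by
        rw [Matrix.mul_vecMulVec]
        exact Matrix.ext h0
      rw [← one_mul (Matrix.vecMulVec ζ η), ← hHG, mul_assoc, this, mul_zero]
    have hji : (G.mulVec ζ) j * η i ≠ 0 := by
      intro h0
      rw [hSij j i, h0, mul_zero] at hij
      exact hij rfl
    have hii := mul_ne_zero (left_ne_zero_of_mul hij) (right_ne_zero_of_mul hji)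
    have h1 := hSij i i
    exact (mul_right_cancel₀ hii (by rw [one_mul]; exact h1)).symm
  rw [hl1, one_smul] at hl
  refine ⟨?_, fun X => ?_⟩
  · let E : Matrix (Fin n) (Fin n) k ≃ₗ[k] Matrix (Fin n) (Fin n) k :=
      LinearEquiv.ofLinearMap (LinearMap.mulLeft k G) (LinearMap.mulLeft k H)
        (by ext1 X; simp [← mul_assoc, hGH]) (by ext1 X; simp [← mul_assoc, hHG])
    have hE (X) : E X = G * X := rfl
    have himg : E '' {X | τ X = X} = {X | X.IsSymm} := by
      ext Y
      constructor
      · rintro ⟨X, hX, rfl⟩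
        have hX : τ X = X := hX
        change (E X).transpose = E X
        rw [hE, Matrix.transpose_mul, hl]
        conv_rhs => rw [← hX, hτ, mul_assoc H, ← mul_assoc, hGH, one_mul]
      · intro hY
        have hY : Y.transpose = Y := hY
        refine ⟨H * Y, ?_, by rw [hE, ← mul_assoc, hGH, one_mul]⟩
        change τ (H * Y) = H * Y
        have : H.transpose * G = 1 := by rw [← hl, hGHt]
        rw [hτ, Matrix.transpose_mul, hY, mul_assoc, mul_assoc, this, mul_one]
    rw [← LinearEquiv.finrank_map_eq E, Submodule.map_span]
    change 2 * Module.finrank k (Submodule.span k (E '' {X | τ X = X})) = _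
    rw [himg, Matrix.finrank_span_isSymm]
  · rw [hτ, Matrix.det_mul, Matrix.det_mul, Matrix.det_transpose, mul_right_comm,
      ← Matrix.det_mul, hHG, Matrix.det_one, one_mul]

theorem Matrix.det_one_sub_two_mul_vecMulVec {n : ℕ} {k : Type*} [Field k] (ξ η : Fin n → k)
    (h : η ⬝ᵥ ξ = 1) : (1 - 2 * Matrix.vecMulVec ξ η).det = -1 := by
  have h1 : (1 : Matrix (Fin n) (Fin n) k) - 2 * Matrix.vecMulVec ξ η =
      1 + Matrix.replicateCol Unit ((-2 : k) • ξ) * Matrix.replicateRow Unit η := by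
    rw [two_mul]
    ext i j
    simp [Matrix.mul_apply, Matrix.vecMulVec_apply]
    ring
  rw [h1, Matrix.det_one_add_replicateCol_mul_replicateRow, dotProduct_smul, h]
  norm_num

theorem Matrix.det_eq_neg_one_of_symm_perturbation {n : ℕ} {k : Type*} [Field k]
    {τ : Matrix (Fin n) (Fin n) k → Matrix (Fin n) (Fin n) k} (hdet : ∀ X, (τ X).det = X.det)
    {v b b' f s z c : Matrix (Fin n) (Fin n) k} {ξ η : Fin n → k} (hηξ : η ⬝ᵥ ξ = 1)
    (hb : b = 1 + v) (hb' : b' * v = b) (hbf : b * f = 0) (hbf' : b' * f = 0) (hff : f * f = f)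
    (hsf : s * f = s)
    (hzf : z * f = z) (hpf : Matrix.vecMulVec ξ η * f = Matrix.vecMulVec ξ η)
    (hc : c = b' + s + z) (hcp : c * Matrix.vecMulVec ξ η = z) (hτc : τ c = b - s + z)
    (hcu : IsUnit c) : v.det = -1 := by
  set p := Matrix.vecMulVec ξ η with hp
  have hcf : c * f = s + z := by rw [hc, add_mul, add_mul, hbf', hsf, hzf, zero_add]
  have hvf : v * f = -f := by
    have : (1 + v) * f = 0 := by rw [← hb, hbf]
    rw [add_mul, one_mul] at this
    exact eq_neg_of_add_eq_zero_right this
  set y := (1 - f) * v - f with hy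
  have hX : c * ((1 - 2 * p) * y) = τ c := by
    have h1 : (1 - 2 * p) * y = (1 - f) * v - f + 2 * p := by
      have h2 : p * y = -p := by
        rw [hy, mul_sub, ← mul_assoc, mul_sub, mul_one, hpf, sub_self, zero_mul, zero_sub]
      rw [sub_mul, one_mul, mul_assoc, h2, hy]
      noncomm_ring
    have h3 : c * (1 - f) = b' := by
      rw [mul_sub, mul_one, hcf, hc]
      abel
    rw [h1, mul_add, mul_sub, ← mul_assoc, h3, hb', hcf, two_mul, mul_add, hcp, hτc]
    abel
  have hv : y * (1 - f * ((v + 1) * (1 - f))) = v := by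
    have h1 : y * f = -f := by
      rw [hy, sub_mul, mul_assoc, hvf, sub_mul, hff, one_mul, mul_neg, hff]
      abel
    have h2 : f * ((v + 1) * (1 - f)) = f * v + f := by
      have : (v + 1) * f = 0 := by rw [add_mul, hvf, one_mul, neg_add_cancel]
      rw [mul_sub (v + 1), this, mul_one, sub_zero, mul_add, mul_one]
    rw [mul_sub, mul_one, ← mul_assoc, h1, neg_mul, h2, hy]
    noncomm_ring
  have hdν : (1 - f * ((v + 1) * (1 - f))).det = 1 := by
    rw [Matrix.det_one_sub_mul_comm, mul_assoc, sub_mul, one_mul, hff, sub_self, mul_zero,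
      sub_zero, Matrix.det_one]
  have hdy : y.det = v.det := by
    conv_rhs => rw [← hv, Matrix.det_mul, hdν, mul_one]
  have hcd : c.det ≠ 0 := ((Matrix.isUnit_iff_isUnit_det c).1 hcu).ne_zero
  have h1 := congrArg Matrix.det hX
  rw [hdet, Matrix.det_mul, Matrix.det_mul, Matrix.det_one_sub_two_mul_vecMulVec ξ η hηξ, hdy]
    at h1
  have h2 := mul_left_cancel₀ hcd (h1.trans (mul_one _).symm)
  linear_combination -h2

theorem IsSemisimpleRing.exists_idempotent_annihilator {R : Type*} [Ring R] [IsSemisimpleRing R]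
    (c : R) : ∃ g : R, g * g = g ∧ c * g = 0 ∧ ∃ y, y * c = 1 - g := by
  obtain ⟨e, he, hI⟩ := IsSemisimpleRing.ideal_eq_span_idempotent (Ideal.span {c})
  have hc : c ∈ Ideal.span {e} := hI ▸ Ideal.mem_span_singleton_self c
  have he' : e ∈ Ideal.span {c} := hI ▸ Ideal.mem_span_singleton_self e
  obtain ⟨x, rfl⟩ := Ideal.mem_span_singleton'.1 hc
  obtain ⟨y, hy⟩ := Ideal.mem_span_singleton'.1 he'
  refine ⟨1 - e, he.one_sub.eq, ?_, y, by rw [hy]; abel⟩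
  rw [mul_assoc, mul_sub, mul_one, he.eq, sub_self, mul_zero]

theorem IsSemisimpleRing.isUnit_of_mul_right {R : Type*} [Ring R] [IsSemisimpleRing R]
    {c : R} (hc : ∀ x, c * x = 0 → x = 0) : IsUnit c := by
  obtain ⟨g, -, hcg, y, hy⟩ := IsSemisimpleRing.exists_idempotent_annihilator c
  rw [hc g hcg, sub_zero] at hy
  exact IsUnit.of_mul_eq_one y (mul_eq_one_symm hy)

theorem IsSemisimpleRing.isUnit_of_mul_left {R : Type*} [Ring R] [IsSemisimpleRing R]
    {c : R} (hc : ∀ x, x * c = 0 → x = 0) : IsUnit c := by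
  have hinj : Function.Injective (LinearMap.toSpanSingleton R R c) := by
    rw [← LinearMap.ker_eq_bot, LinearMap.ker_eq_bot']
    exact hc
  obtain ⟨y, hy⟩ := IsArtinian.surjective_of_injective_endomorphism _ hinj 1
  exact IsUnit.of_mul_eq_one y (mul_eq_one_symm hy)

/-- A skew perturbation of `star b` supported on the kernel of `b = 1 + v` whose own kernel `gR`
is so small that all elements of `star g * R * g` are symmetric. -/
theorem exists_maximal_skew_perturbation {R : Type*} [Ring R] [StarRing R] [IsSemisimpleRing R]
    {v : R} (hv : star v * v = 1) :
    ∃ f s g : R, f * f = f ∧ (1 + v) * f = 0 ∧ star (1 + v) * f = 0 ∧ star s = -s ∧ s * f = s ∧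
      g * g = g ∧ g * f = g ∧ s * g = 0 ∧ (1 + v) * g = 0 ∧ star (1 + v) * g = 0 ∧
      (∀ x, (star (1 + v) + s) * x = 0 → g * x = x) ∧
      (∀ x, x * (star (1 + v) + s) = 0 → x * star g = x) ∧
      ∀ a, star (star g * a * g) = star g * a * g := by
  have hv' : v * star v = 1 := mul_eq_one_symm hv
  set b := 1 + v with hb
  have hbv : b = v * star b := by
    rw [hb, star_add, star_one, mul_add, mul_one, hv', add_comm]
  have hbv' : star b = star v * b := by
    rw [hb, star_add, star_one, mul_add, mul_one, hv, add_comm]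
  obtain ⟨f, hff, hbf, yf, hyf⟩ := IsSemisimpleRing.exists_idempotent_annihilator b
  have hbf' : star b * f = 0 := by rw [hbv', mul_assoc, hbf, mul_zero]
  have hfb : ∀ x, b * x = 0 → f * x = x := by
    intro x hx
    have : (1 - f) * x = 0 := by rw [← hyf, mul_assoc, hx, mul_zero]
    rw [sub_mul, one_mul] at this
    exact (sub_eq_zero.1 this).symm
  have hfb1 : star f * star b = 0 := by rw [← star_mul, hbf, star_zero]
  have hfb2 : star f * b = 0 := by
    have := congrArg star hbf'
    rwa [star_mul, star_star, star_zero] at this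
  obtain ⟨I, ⟨s, hs, hsf, rfl⟩, hmax⟩ := (wellFounded_gt (α := Ideal R)).has_min
    {I | ∃ s : R, star s = -s ∧ s * f = s ∧ I = Ideal.span {star b + s}}
    ⟨_, 0, by simp, by simp, rfl⟩
  have hfs : star f * s = s := by
    have := congrArg star hsf
    rwa [star_mul, hs, mul_neg, neg_inj] at this
  obtain ⟨g₀, hgg₀, hcg₀, y, hy⟩ := IsSemisimpleRing.exists_idempotent_annihilator (star b + s)
  have hker : ∀ x, (star b + s) * x = 0 → s * x = 0 ∧ star b * x = 0 := by
    intro x hx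
    have h1 : s * x = 0 := by
      have : star f * ((star b + s) * x) = s * x := by
        rw [← mul_assoc, mul_add, hfb1, hfs, zero_add]
      rw [← this, hx, mul_zero]
    rw [add_mul, h1, add_zero] at hx
    exact ⟨h1, hx⟩
  have hker' : ∀ x, (b - s) * x = 0 → (star b + s) * x = 0 := by
    intro x hx
    have h1 : s * x = 0 := by
      have : star f * ((b - s) * x) = -(s * x) := by
        rw [← mul_assoc, mul_sub, hfb2, hfs, zero_sub, neg_mul]
      rw [hx, mul_zero] at this
      exact neg_eq_zero.1 this.symm
    rw [sub_mul, h1, sub_zero] at hx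
    rw [add_mul, h1, hbv', mul_assoc, hx, mul_zero, add_zero]
  have hfg₀ : f * g₀ = g₀ := by
    apply hfb
    rw [hbv, mul_assoc, (hker _ hcg₀).2, mul_zero]
  set g := g₀ * f with hg
  have hcg : (star b + s) * g = 0 := by rw [hg, ← mul_assoc, hcg₀, zero_mul]
  obtain ⟨hsg, hbg'⟩ := hker _ hcg
  have hbg : b * g = 0 := by rw [hbv, mul_assoc, hbg', mul_zero]
  have hgf : g * f = g := by rw [hg, mul_assoc, hff]
  have hggg : g * g = g := by
    rw [hg, mul_assoc, ← mul_assoc f, hfg₀, ← mul_assoc, hgg₀]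
  have hgx : ∀ x, (star b + s) * x = 0 → g * x = x := by
    intro x hx
    have h1 : (1 - g₀) * x = 0 := by rw [← hy, mul_assoc, hx, mul_zero]
    rw [sub_mul, one_mul, sub_eq_zero] at h1
    have h2 : f * x = x := hfb x (by rw [hbv, mul_assoc, (hker x hx).2, mul_zero])
    rw [hg, mul_assoc, h2, ← h1]
  have hgc : star g * (star b + s) = 0 := by
    have h1 : (b - s) * g = 0 := by rw [sub_mul, hbg, hsg, sub_zero]
    have h2 := congrArg star h1
    rwa [star_mul, star_sub, hs, sub_neg_eq_add, star_zero] at h2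
  refine ⟨f, s, g, hff, hbf, hbf', hs, hsf, hggg, hgf, hsg, hbg, hbg', hgx, ?_, ?_⟩
  · intro x hx
    have h1 := congrArg star hx
    rw [star_mul, star_add, star_star, hs, ← sub_eq_add_neg, star_zero] at h1
    have h2 := congrArg star (hgx _ (hker' _ h1))
    rwa [star_mul, star_star] at h2
  · intro a
    have hgg' : star g * star g = star g := by rw [← star_mul, hggg]
    set t := star g * a * g - star (star g * a * g) with ht
    have hst : star t = -t := by rw [ht, star_sub, star_star]; abel
    have htg : t * g = t := by
      rw [ht]
      simp only [star_mul, star_star, sub_mul, mul_assoc, hggg]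
    have hgt : star g * t = t := by
      rw [ht]
      simp only [star_mul, star_star, mul_sub, ← mul_assoc, hgg']
    have htf : t * f = t := by rw [← htg, mul_assoc, hgf]
    have hle : Ideal.span {star b + s} ≤ Ideal.span {star b + (s + t)} := by
      rw [Ideal.span_singleton_le_iff_mem, Ideal.mem_span_singleton']
      refine ⟨1 - star g, ?_⟩
      rw [← add_assoc, mul_add, sub_mul, sub_mul, hgc, hgt]
      simp
    have hmem : star b + (s + t) ∈ Ideal.span {star b + s} := by
      have h1 := hmax _ ⟨s + t, by rw [star_add, hs, hst]; abel, by rw [add_mul, hsf, htf], rfl⟩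
      have h2 := eq_of_le_of_not_lt hle h1
      rw [h2]
      exact Ideal.mem_span_singleton_self _
    obtain ⟨w, hw⟩ := Ideal.mem_span_singleton'.1 hmem
    have h3 : t = 0 := by
      have h4 : (star b + (s + t)) * g = 0 := by rw [← hw, mul_assoc, hcg, mul_zero]
      rwa [← add_assoc, add_mul, hcg, zero_add, htg] at h4
    exact (sub_eq_zero.1 h3).symm

/-- In a split component with a first-kind involution, a kernel of rank one left over by a maximal
skew perturbation contradicts the determinant condition. -/
theorem U0Mem.false_of_rank_one_kernel {R : Type v} [Ring R] [StarRing R] {v : R}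
    (hv : U0Mem (star : R → R) v) {f s g : R}
    (hff : f * f = f) (hbf : (1 + v) * f = 0) (hbf' : star (1 + v) * f = 0) (hs : star s = -s)
    (hsf : s * f = s) (hgf : g * f = g) (hsg : s * g = 0)
    (hbg' : star (1 + v) * g = 0)
    {n : ℕ} {k : Type v} [Field k] (h2 : (2 : k) ≠ 0) (π : R →+* Matrix (Fin n) (Fin n) k)
    (hπ : Function.Surjective π) (τ : Matrix (Fin n) (Fin n) k → Matrix (Fin n) (Fin n) k)
    (hπτ : ∀ x, π (star x) = τ (π x))
    (hker : ∀ x, π (star (1 + v) + s) * x = 0 → π g * x = x)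
    (hgc : τ (π g) * π (star (1 + v) + s) = 0)
    (hgg : π g * π g = π g)
    (hsymm : ∀ m, τ (τ (π g) * m * π g) = τ (π g) * m * π g)
    (hτg : τ (π g) ≠ 0)
    (ξ η : Fin n → k) (hp : π g = Matrix.vecMulVec ξ η) (hηξ : η ⬝ᵥ ξ = 1) : False := by
  have hadd : ∀ X Y, τ (X + Y) = τ X + τ Y := by
    intro X Y
    obtain ⟨x, rfl⟩ := hπ X
    obtain ⟨y, rfl⟩ := hπ Y
    rw [← map_add, ← hπτ, star_add, map_add, hπτ, hπτ]
  have hmul : ∀ X Y, τ (X * Y) = τ Y * τ X := by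
    intro X Y
    obtain ⟨x, rfl⟩ := hπ X
    obtain ⟨y, rfl⟩ := hπ Y
    rw [← map_mul, ← hπτ, star_mul, map_mul, hπτ, hπτ]
  have hinv : ∀ X, τ (τ X) = X := by
    intro X
    obtain ⟨x, rfl⟩ := hπ X
    rw [← hπτ, ← hπτ, star_star]
  have hg0 : π g ≠ 0 := by
    intro h0
    apply hτg
    rw [h0, ← map_zero π, ← hπτ, star_zero]
  obtain ⟨m, hm⟩ : ∃ m, τ (π g) * m * π g ≠ 0 := by
    by_contra! h
    rcases Matrix.eq_zero_or_eq_zero_of_forall_mul_mul_eq_zero h with h | h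
    exacts [hτg h, hg0 h]
  have hscal : ∀ c : k, τ (c • (1 : Matrix (Fin n) (Fin n) k)) = c • 1 := by
    intro c
    set T := τ (c • (1 : Matrix (Fin n) (Fin n) k)) with hT
    have hcent : ∀ X, T * X = X * T := by
      intro X
      rw [← hinv X, hT, ← hmul, ← hmul]
      simp
    have h1 : (τ (π g) * m * π g) * (T - c • 1) = 0 := by
      have h3 := hsymm (c • m)
      have h4 : τ (π g) * (c • m) * π g = (c • (1 : Matrix (Fin n) (Fin n) k)) *
        (τ (π g) * m * π g) := by simp
      rw [h4, hmul, hsymm, ← hT] at h3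
      rw [mul_sub, h3]
      simp
    have h5 : ∀ X, (τ (π g) * m * π g) * X * (T - c • 1) = 0 := by
      intro X
      have : X * (T - c • 1) = (T - c • 1) * X := by
        rw [mul_sub, sub_mul, hcent]
        simp
      rw [mul_assoc, this, ← mul_assoc, h1, zero_mul]
    rcases Matrix.eq_zero_or_eq_zero_of_forall_mul_mul_eq_zero h5 with h | h
    exacts [absurd h hm, sub_eq_zero.1 h]
  set z := τ (π g) * m * π g with hz
  have hzη : z = Matrix.vecMulVec ((τ (π g) * m).mulVec ξ) η := by
    rw [hz, hp, Matrix.mul_vecMulVec]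
  obtain ⟨hdim, hdet⟩ := Matrix.orthogonal_of_symm_rank_one τ hadd hmul hinv hscal _ η
    (hzη ▸ hm) (hzη ▸ hsymm m)
  have hdet1 : (π v).det = 1 := hv.2 n k π τ hπ hπτ hadd hmul hinv hscal hdim
  have hzg : z * π g = z := by rw [hz, mul_assoc, hgg]
  have hgz : τ (π g) * z = z := by
    rw [hz, ← mul_assoc, ← mul_assoc, ← hmul, hgg]
  have hπgf : π g * π f = π g := by rw [← map_mul, hgf]
  have hdet2 : (π v).det = -1 := by
    refine Matrix.det_eq_neg_one_of_symm_perturbation hdet (b := π (1 + v))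
      (b' := π (star (1 + v))) (f := π f) (s := π s) (z := z)
      (c := π (star (1 + v)) + π s + z) hηξ (by simp) ?_ ?_ ?_ ?_ ?_ ?_ ?_ rfl ?_ ?_ ?_
    · rw [← map_mul]
      congr 1
      rw [star_add, add_mul, hv.1, star_one, one_mul, add_comm]
    · rw [← map_mul, hbf, map_zero]
    · rw [← map_mul, hbf', map_zero]
    · rw [← map_mul, hff]
    · rw [← map_mul, hsf]
    · rw [hz, mul_assoc, hπgf]
    · rw [← hp, hπgf]
    · rw [← hp, add_mul, add_mul, ← map_mul, ← map_mul, hbg', hsg, hzg]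
      simp
    · rw [hadd, hadd, ← hπτ, ← hπτ, star_star, hs, hsymm, map_neg, sub_eq_add_neg]
    · apply IsSemisimpleRing.isUnit_of_mul_right
      intro x hx
      rw [← map_add] at hx
      have h1 : z * x = 0 := by
        have h3 := congrArg (τ (π g) * ·) hx
        simpa only [add_mul, mul_add, ← mul_assoc, hgc, hgz, zero_mul, zero_add, mul_zero] using h3
      rw [add_mul, h1, add_zero] at hx
      have hx' := hker x hx
      obtain ⟨ζ, hζ⟩ : ∃ ζ, (τ (π g) * m).mulVec ξ = ζ := ⟨_, rfl⟩
      rw [hζ] at hzη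
      rw [hzη, Matrix.vecMulVec_mul] at h1
      have hηx : Matrix.vecMul η x = 0 := by
        obtain ⟨i, hi⟩ : ∃ i, ζ i ≠ 0 := by
          by_contra! h0
          apply hm
          rw [hzη]
          ext i j
          simp [Matrix.vecMulVec_apply, h0]
        funext j
        have h3 := congrFun (congrFun h1 i) j
        rw [Matrix.vecMulVec_apply] at h3
        exact (mul_eq_zero.1 h3).resolve_left hi
      rw [← hx', hp, Matrix.vecMulVec_mul, hηx, Matrix.vecMulVec_zero]
  rw [hdet1] at hdet2
  apply h2
  linear_combination hdet2

/-- The kernel idempotent left over by a maximal skew perturbation vanishes in each simple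
component `M_n(D)`. -/
theorem U0Mem.map_kernel_idempotent_eq_zero {R : Type v} [Ring R] [StarRing R]
    (h2 : IsUnit (2 : R)) {v : R} (hv : U0Mem (star : R → R) v) {f s g : R}
    (hff : f * f = f) (hbf : (1 + v) * f = 0) (hbf' : star (1 + v) * f = 0) (hs : star s = -s)
    (hsf : s * f = s) (hgg : g * g = g) (hgf : g * f = g) (hsg : s * g = 0)
    (hbg : (1 + v) * g = 0) (hbg' : star (1 + v) * g = 0)
    (hker : ∀ x, (star (1 + v) + s) * x = 0 → g * x = x)
    (hker' : ∀ x, x * (star (1 + v) + s) = 0 → x * star g = x)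
    (hsymm : ∀ a, star (star g * a * g) = star g * a * g)
    {n : ℕ} {D : Type v} [DivisionRing D] (π : R →+* Matrix (Fin n) (Fin n) D)
    (ι : Matrix (Fin n) (Fin n) D → R) (hι0 : ι 0 = 0) (hπι : ∀ X, π (ι X) = X)
    (hιπ : ∀ x, ι (π x) = x * ι 1) (hιπ' : ∀ x, ι (π x) = ι 1 * x) : π g = 0 := by
  by_contra hg0
  have hπ : Function.Surjective π := fun X => ⟨ι X, hπι X⟩
  have hecomm : ∀ x, x * ι 1 = ι 1 * x := fun x => by rw [← hιπ, hιπ']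
  have hιe : ∀ X, ι X * ι 1 = ι X := fun X => by rw [← hιπ, hπι]
  have hιe' : ∀ X, ι 1 * ι X = ι X := fun X => by rw [← hιπ', hπι]
  have hgs0 : π (star g) ≠ 0 := by
    intro h0
    have hu : IsUnit (π (star (1 + v) + s)) := by
      apply IsSemisimpleRing.isUnit_of_mul_left
      intro x hx
      have h1 : ι x * (star (1 + v) + s) = 0 := by
        rw [← hιe' x, mul_assoc, ← hιπ', map_mul, hπι, hx, hι0]
      have h3 := congrArg π (hker' _ h1)
      rwa [map_mul, h0, mul_zero, hπι, eq_comm] at h3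
    apply hg0
    apply hu.mul_left_cancel
    rw [mul_zero, ← map_mul, add_mul, hbg', hsg, add_zero, map_zero]
  have hse : star (ι 1) = ι 1 := by
    obtain ⟨m, hm⟩ : ∃ m, π (star g) * m * π g ≠ 0 := by
      by_contra! h
      rcases Matrix.eq_zero_or_eq_zero_of_forall_mul_mul_eq_zero h with h | h
      exacts [hgs0 h, hg0 h]
    have hze : (star g * ι m * g) * ι 1 = star g * ι m * g := by
      rw [hecomm, ← mul_assoc, ← mul_assoc, ← hecomm, mul_assoc (star g), hιe']
    have hez : star (ι 1) * (star g * ι m * g) = star g * ι m * g := by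
      have h1 := congrArg star hze
      rwa [star_mul, hsymm] at h1
    have hcent : ∀ X, π (star (ι 1)) * X = X * π (star (ι 1)) := by
      intro X
      obtain ⟨x, rfl⟩ := hπ X
      rw [← map_mul, ← map_mul]
      congr 1
      have h1 := congrArg star (hecomm (star x))
      rwa [star_mul, star_mul, star_star] at h1
    have hprod : ∀ X, (1 - π (star (ι 1))) * X * (π (star g) * m * π g) = 0 := by
      intro X
      have h1 : (1 - π (star (ι 1))) * (π (star g) * m * π g) = 0 := by
        have h3 := congrArg π hez
        simp only [map_mul, hπι] at h3
        rw [sub_mul, one_mul, h3, sub_self]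
      have h4 : (1 - π (star (ι 1))) * X = X * (1 - π (star (ι 1))) := by
        rw [sub_mul, mul_sub, hcent, one_mul, mul_one]
      rw [h4, mul_assoc, h1, mul_zero]
    rcases Matrix.eq_zero_or_eq_zero_of_forall_mul_mul_eq_zero hprod with h | h
    · have h1 : ι 1 * star (ι 1) = ι 1 := by
        rw [← hιπ', ← sub_eq_zero.1 h]
      have h3 := congrArg star h1
      rw [star_mul, star_star] at h3
      exact h3.symm.trans h1
    · exact absurd h hm
  let τ : Matrix (Fin n) (Fin n) D → Matrix (Fin n) (Fin n) D := fun X => π (star (ι X))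
  have hπτ : ∀ x, π (star x) = τ (π x) := by
    intro x
    simp only [τ]
    rw [hιπ, star_mul, hse, map_mul, hπι, one_mul]
  have hmul : ∀ X Y, τ (X * Y) = τ Y * τ X := by
    intro X Y
    obtain ⟨x, rfl⟩ := hπ X
    obtain ⟨y, rfl⟩ := hπ Y
    rw [← map_mul, ← hπτ, star_mul, map_mul, hπτ, hπτ]
  have hsymmτ : ∀ m, τ (τ (π g) * m * π g) = τ (π g) * m * π g := by
    intro m
    obtain ⟨a, rfl⟩ := hπ m
    rw [← hπτ, ← map_mul, ← map_mul, ← hπτ, hsymm]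
  have hpp : π g * π g = π g := by rw [← map_mul, hgg]
  have hτg : τ (π g) ≠ 0 := by rwa [← hπτ]
  have hswap : ∀ m x, (τ (π g) * m * π g) * (π g * x * π g) =
      τ (π g * x * π g) * (τ (π g) * m * π g) := by
    intro m x
    have h1 := hsymmτ (m * π g * π g * x)
    have h3 : τ (π g) * (m * π g * π g * x) * π g =
        (τ (π g) * m * π g) * (π g * x * π g) := by simp only [mul_assoc]
    rw [h3, hmul, hsymmτ] at h1
    exact h1.symm
  have hcomm : ∀ x y, (π g * x * π g) * (π g * y * π g) =
      (π g * y * π g) * (π g * x * π g) := by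
    intro x y
    have hcorner : ∀ x y, (π g * x * π g) * (π g * y * π g) =
        π g * (x * π g * π g * y) * π g := fun x y => by simp only [mul_assoc]
    have h1 : ∀ m, τ (π g) * m *
        ((π g * x * π g) * (π g * y * π g) - (π g * y * π g) * (π g * x * π g)) = 0 := by
      intro m
      have hpX : ∀ x, π g * (π g * x * π g) = π g * x * π g := fun x => by
        rw [← mul_assoc, ← mul_assoc, hpp]
      have h3 : (τ (π g) * m * π g) * ((π g * x * π g) * (π g * y * π g)) =
          (τ (π g) * m * π g) * ((π g * y * π g) * (π g * x * π g)) := by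
        rw [← mul_assoc, hswap, mul_assoc, hswap, ← mul_assoc, ← hmul, hcorner y x, hswap]
      rw [mul_assoc (τ (π g) * m), mul_assoc (τ (π g) * m),
        ← mul_assoc (π g) (π g * x * π g), hpX, ← mul_assoc (π g) (π g * y * π g), hpX] at h3
      rw [mul_sub, h3, sub_self]
    rcases Matrix.eq_zero_or_eq_zero_of_forall_mul_mul_eq_zero h1 with h | h
    exacts [absurd h hτg, sub_eq_zero.1 h]
  obtain ⟨hD, ξ, η, hp, hηξ⟩ := Matrix.rank_one_of_commutative_corner hpp hg0 hcomm
  have h2D : (2 : D) ≠ 0 := by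
    intro h0
    apply hg0
    have h1 : IsUnit (π 2) := h2.map π
    apply h1.mul_left_cancel
    rw [mul_zero, map_ofNat, two_mul]
    ext i j
    rw [Matrix.add_apply, ← two_mul, h0, zero_mul, Matrix.zero_apply]
  have hgc : star g * (star (1 + v) + s) = 0 := by
    have h1 : (1 + v - s) * g = 0 := by rw [sub_mul, hbg, hsg, sub_zero]
    have h3 := congrArg star h1
    rwa [star_mul, star_sub, hs, sub_neg_eq_add, star_zero] at h3
  let _ : Field D := { (inferInstance : DivisionRing D) with mul_comm := hD }
  refine U0Mem.false_of_rank_one_kernel hv hff hbf hbf' hs hsf hgf hsg hbg' h2D π hπ τ hπτ ?_ ?_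
    hpp hsymmτ hτg ξ η hp hηξ
  · intro x hx
    have h1 : (star (1 + v) + s) * ι x = 0 := by
      rw [← hιe x, ← mul_assoc, ← hιπ, map_mul, hπι]
      exact (congrArg ι hx).trans hι0
    have h3 := congrArg π (hker _ h1)
    rwa [map_mul, hπι] at h3
  · rw [← hπτ, ← map_mul, hgc, map_zero]

/-- Every element `v` of `U⁰` of a semisimple ring is given by `1 + v = b c⁻¹ star b` with
`b = 1 + v` and a unit `c` such that `c + star c = star b * b`. -/
theorem U0Mem.exists_unit_wall_form {R : Type v} [Ring R] [StarRing R] [IsSemisimpleRing R]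
    (h2 : IsUnit (2 : R)) {v : R} (hv : U0Mem (star : R → R) v) :
    ∃ c : Rˣ, (c : R) + star (c : R) = star (1 + v) * (1 + v) ∧
      (1 + v) * ↑c⁻¹ * star (1 + v) = 1 + v := by
  obtain ⟨f, s, g, hff, hbf, hbf', hs, hsf, hgg, hgf, hsg, hbg, hbg', hker, hker', hsymm⟩ :=
    exists_maximal_skew_perturbation hv.1
  obtain ⟨n, D, d, _, -, ⟨φ⟩⟩ := IsSemisimpleRing.exists_ringEquiv_pi_matrix_divisionRing R
  have hg : g = 0 := by
    apply φ.injective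
    rw [map_zero]
    funext i
    refine U0Mem.map_kernel_idempotent_eq_zero h2 hv hff hbf hbf' hs hsf hgg hgf hsg hbg hbg' hker
      hker' hsymm ((Pi.evalRingHom _ i).comp φ.toRingHom) (fun X => φ.symm (Pi.single i X))
      (by simp) (fun X => by simp) (fun x => ?_) (fun x => ?_)
    · apply φ.injective
      funext j
      rw [map_mul]
      by_cases hj : j = i
      · subst hj
        simp
      · simp [hj]
    · apply φ.injective
      funext j
      rw [map_mul]
      by_cases hj : j = i
      · subst hj
        simp
      · simp [hj]
  have hu : IsUnit (star (1 + v) + s) := by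
    apply IsSemisimpleRing.isUnit_of_mul_right
    intro x hx
    rw [← hker x hx, hg, zero_mul]
  obtain ⟨c, hc⟩ := hu
  have hcf : (↑c⁻¹ : R) * s = f := by
    rw [Units.inv_mul_eq_iff_eq_mul, hc, add_mul, hbf', hsf, zero_add]
  refine ⟨c, ?_, ?_⟩
  · simp only [hc, hs, star_add, star_star, star_one, mul_add, add_mul, hv.1]
    noncomm_ring
  · have h1 : star (1 + v) = c - s := by rw [hc]; abel
    rw [h1, mul_assoc, mul_sub, Units.inv_mul, hcf, mul_sub, hbf, mul_one, sub_zero]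

theorem isUnit_of_map_of_ker_jacobson {A B : Type*} [Ring A] [Ring B] (ρ : A →+* B)
    (hsurj : Function.Surjective ρ) (hker : ∀ a, ρ a = 0 → a ∈ Ideal.jacobson (⊥ : Ideal A))
    {a : A} (ha : IsUnit (ρ a)) : IsUnit a := by
  have hleft : ∀ x, ρ x = 1 → ∃ y, y * x = 1 ∧ ρ y = 1 := by
    intro x hx
    have hx1 : ρ (x - 1) = 0 := by rw [map_sub, hx, map_one, sub_self]
    obtain ⟨y, hy⟩ := Ideal.mem_jacobson_iff.1 (hker (x - 1) hx1) 1
    rw [Ideal.mem_bot, sub_eq_zero, mul_one, mul_sub, mul_one, sub_add_cancel] at hy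
    refine ⟨y, hy, ?_⟩
    have h1 := congrArg ρ hy
    rwa [map_mul, hx, mul_one, map_one] at h1
  have hunit : ∀ x, ρ x = 1 → IsUnit x := by
    intro x hx
    obtain ⟨y, hyx, hy⟩ := hleft x hx
    obtain ⟨w, hwy, -⟩ := hleft y hy
    have : w = x := by rw [← mul_one w, ← hyx, ← mul_assoc, hwy, one_mul]
    exact ⟨⟨x, y, this ▸ hwy, hyx⟩, rfl⟩
  obtain ⟨c, hc⟩ := ha
  obtain ⟨y, hy⟩ := hsurj ↑c⁻¹
  have h1 := hunit (a * y) (by rw [map_mul, hy, ← hc, Units.mul_inv])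
  have h3 := hunit (y * a) (by rw [map_mul, hy, ← hc, Units.inv_mul])
  obtain ⟨p, hp⟩ := h1.exists_right_inv
  obtain ⟨q, hq⟩ := h3.exists_left_inv
  rw [mul_assoc] at hp
  rw [← mul_assoc] at hq
  have : q * y = y * p := by rw [← mul_one (q * y), ← hp, ← mul_assoc, hq, one_mul]
  exact ⟨⟨a, y * p, hp, this ▸ hq⟩, rfl⟩

theorem star_mul_self_of_unit_wall_form {A : Type*} [Ring A] [StarRing A] (w : A) (c : Aˣ)
    (hc : (c : A) + star (c : A) = star w * w) :
    star (1 - w * ↑c⁻¹ * star w) * (1 - w * ↑c⁻¹ * star w) = 1 := by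
  have h1 : star (↑c⁻¹ : A) * star (c : A) = 1 := by rw [← star_mul, Units.mul_inv, star_one]
  have h3 : star (↑c⁻¹ : A) * (star w * w) * (↑c⁻¹ : A) = star (↑c⁻¹ : A) + ↑c⁻¹ := by
    rw [← hc, mul_add, add_mul, h1, one_mul, mul_assoc, Units.mul_inv, mul_one]
  have h4 : star (1 - w * ↑c⁻¹ * star w) = 1 - w * star (↑c⁻¹ : A) * star w := by
    simp [mul_assoc]
  rw [h4]
  calc (1 - w * star (↑c⁻¹ : A) * star w) * (1 - w * ↑c⁻¹ * star w)
      = 1 - w * (star (↑c⁻¹ : A) + ↑c⁻¹) * star w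
        + w * (star (↑c⁻¹ : A) * (star w * w) * (↑c⁻¹ : A)) * star w := by noncomm_ring
    _ = 1 := by rw [h3]; abel

/-- **Theorem.** Let `(A,σ)` be a semilocal ring with involution such that `2 ∈ Aˣ`.
Write `Ā = A/Jac(A)` (realized as a surjective ring homomorphism `ρ : A → Ā` whose kernel
is the Jacobson radical, so that `Ā` is semisimple artinian), and let `σ̄` be the induced
involution on `Ā`. Then the image of `u ↦ ū : U(A,σ) → U(Ā,σ̄)` contains `U⁰(Ā,σ̄)`. -/
theorem U0_of_semisimple_quotient_lifts
    (A : Type u) (Abar : Type v) [Ring A] [Ring Abar]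
    (h2 : IsUnit (2 : A))
    (σ : A → A)
    (hadd : ∀ x y : A, σ (x + y) = σ x + σ y)
    (hmul : ∀ x y : A, σ (x * y) = σ y * σ x)
    (hinv : ∀ x : A, σ (σ x) = x)
    (ρ : A →+* Abar)
    (hρsurj : Function.Surjective ρ)
    (hρker : ∀ a : A, ρ a = 0 ↔ a ∈ Ideal.jacobson (⊥ : Ideal A))
    (hsemilocal : IsSemisimpleRing Abar)
    (σbar : Abar → Abar)
    (hcompat : ∀ a : A, ρ (σ a) = σbar (ρ a))
    (v : Abar) (hv : U0Mem σbar v) :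
    ∃ u : A, σ u * u = 1 ∧ ρ u = v := by
  let _ : StarRing A :=
    { star := σ, star_involutive := hinv, star_mul := hmul, star_add := hadd }
  let _ : StarRing Abar :=
    { star := σbar
      star_involutive := fun x => by
        obtain ⟨a, rfl⟩ := hρsurj x
        rw [← hcompat, ← hcompat, hinv]
      star_mul := fun x y => by
        obtain ⟨a, rfl⟩ := hρsurj x
        obtain ⟨b, rfl⟩ := hρsurj y
        rw [← map_mul, ← hcompat, hmul, map_mul, hcompat, hcompat]
      star_add := fun x y => by
        obtain ⟨a, rfl⟩ := hρsurj x
        obtain ⟨b, rfl⟩ := hρsurj y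
        rw [← map_add, ← hcompat, hadd, map_add, hcompat, hcompat] }
  have hρstar (a : A) : ρ (star a) = star (ρ a) := hcompat a
  have hv' : U0Mem (star : Abar → Abar) v := hv
  have h2bar : IsUnit (2 : Abar) := map_ofNat ρ 2 ▸ h2.map ρ
  obtain ⟨c, hc, hcv⟩ := hv'.exists_unit_wall_form h2bar
  obtain ⟨v₀, rfl⟩ := hρsurj v
  obtain ⟨c₀, hc₀⟩ := hρsurj (c : Abar)
  obtain ⟨t, ht, ht'⟩ : ∃ t : A, 2 * t = 1 ∧ t * 2 = 1 :=
    ⟨↑h2.unit⁻¹, h2.mul_val_inv, h2.val_inv_mul⟩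
  have htc (x : A) : t * x = x * t := by
    have h1 : 2 * x = x * 2 := by rw [two_mul, mul_two]
    calc t * x = t * (x * 2) * t := by rw [mul_assoc, mul_assoc, ht, mul_one]
      _ = x * t := by rw [← h1, ← mul_assoc, ht', one_mul]
  have htt : t + t = 1 := by rw [← two_mul, ht]
  have hst : star t = t := by
    have h1 : star t * 2 = 1 := by
      rw [mul_two, ← star_add, htt, star_one]
    rw [← mul_one (star t), ← ht, ← mul_assoc, h1, one_mul]
  set w := 1 + v₀ with hw
  set C := t * (star w * w + c₀ - star c₀) with hC
  have hCsum : C + star C = star w * w := by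
    have h1 : star C = t * (star w * w + star c₀ - c₀) := by
      rw [hC, star_mul, hst, ← htc]
      simp
    rw [h1, hC, ← mul_add]
    have h3 : star w * w + c₀ - star c₀ + (star w * w + star c₀ - c₀) = 2 * (star w * w) := by
      noncomm_ring
    rw [h3, ← mul_assoc, ht', one_mul]
  have hρC : ρ C = c := by
    have h1 : ρ w = 1 + ρ v₀ := by rw [hw, map_add, map_one]
    have h3 : (c : Abar) = ρ t * (2 * c) := by
      rw [← mul_assoc, ← map_ofNat ρ 2, ← map_mul, ht', map_one, one_mul]
    rw [hC, map_mul, map_sub, map_add, map_mul, hρstar, hρstar, hc₀, h1, ← hc, h3]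
    congr 1
    rw [← h3]
    noncomm_ring
  obtain ⟨Cu, hCu⟩ := isUnit_of_map_of_ker_jacobson ρ hρsurj (fun a => (hρker a).1)
    (hρC ▸ c.isUnit : IsUnit (ρ C))
  have hCu' : ρ (↑Cu⁻¹ : A) = ↑c⁻¹ := by
    have h1 : Units.map (ρ : A →* Abar) Cu = c := by
      ext
      simp [hCu, hρC]
    rw [← h1]
    simp
  refine ⟨-(1 - w * ↑Cu⁻¹ * star w), ?_, ?_⟩
  · change star (-(1 - w * ↑Cu⁻¹ * star w)) * _ = 1
    rw [star_neg, neg_mul_neg]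
    exact star_mul_self_of_unit_wall_form w Cu (hCu ▸ hCsum)
  · have h1 : ρ w = 1 + ρ v₀ := by rw [hw, map_add, map_one]
    rw [map_neg, map_sub, map_mul, map_mul, hρstar, hCu', h1, hcv, map_one]
    abel
end

section
/- Let (A,σ) be a ring with involution such that 2 ∈ A^×. For every y ∈ A and a ∈ Sym_{−1}(A,σ) with ½σ(y)y + a ∈ A^×, the element s_{y,a} := 1 − y(½σ(y)y + a)^{−1}σ(y) satisfies σ(s_{y,a}) s_{y,a} = 1, i.e. s_{y,a} ∈ U(A,σ). -/
universe v

/-- **Proposition.** Let `(A,σ)` be a ring with involution such that `2 ∈ Aˣ`. For every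
`y ∈ A` and `a ∈ Sym₋₁(A,σ)` with `½ σ(y)y + a ∈ Aˣ`, the `1`-reflection
`s_{y,a} = 1 - y (½ σ(y)y + a)⁻¹ σ(y)` satisfies `σ(s_{y,a}) s_{y,a} = 1`,
i.e. `s_{y,a} ∈ U(A,σ)`. -/
theorem reflection_mem_unitary_group
    (A : Type v) [Ring A]
    (h2 : IsUnit (2 : A))
    (σ : A → A)
    (hadd : ∀ x y : A, σ (x + y) = σ x + σ y)
    (hmul : ∀ x y : A, σ (x * y) = σ y * σ x)
    (hinv : ∀ x : A, σ (σ x) = x)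
    (y a : A) (ha : σ a = -a)
    (h : IsUnit (((h2.unit⁻¹ : Aˣ) : A) * (σ y * y) + a)) :
    σ (1 - y * ((h.unit⁻¹ : Aˣ) : A) * σ y) * (1 - y * ((h.unit⁻¹ : Aˣ) : A) * σ y) = 1 := by
  have hone : σ 1 = 1 := by
    have key := hmul 1 (σ 1)
    rw [one_mul, hinv, one_mul] at key
    exact key.symm
  let φ : A →+ A := AddMonoidHom.mk' σ hadd
  have hsub : ∀ x z : A, σ (x - z) = σ x - σ z := map_sub φ
  obtain ⟨t, ht⟩ : ∃ t : A, t = ((h2.unit⁻¹ : Aˣ) : A) := ⟨_, rfl⟩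
  obtain ⟨w, hw⟩ : ∃ w : A, w = ((h.unit⁻¹ : Aˣ) : A) := ⟨_, rfl⟩
  have huw : (t * (σ y * y) + a) * w = 1 := by
    rw [hw, ht]; exact h.mul_val_inv
  have htt : t + t = 1 := by
    rw [← two_mul, ht]; exact h2.mul_val_inv
  have hσt : σ t = t := by
    have hσtt : σ t + σ t = 1 := by rw [← hadd, htt, hone]
    apply h2.mul_left_cancel
    rw [two_mul, two_mul, hσtt, htt]
  have hcomm : σ y * y * t = t * (σ y * y) := by
    apply h2.mul_left_cancel
    rw [two_mul, two_mul, ← mul_add, ← add_mul, htt, mul_one, one_mul]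
  have hσu : σ (t * (σ y * y) + a) = t * (σ y * y) - a := by
    rw [hadd, ha, hmul, hmul, hinv, hσt, hcomm, sub_eq_add_neg]
  have hwu : σ w * (t * (σ y * y) - a) = 1 := by
    rw [← hσu, ← hmul, huw, hone]
  have hsum : (t * (σ y * y) + a) + (t * (σ y * y) - a) = σ y * y := by
    rw [add_add_sub_cancel, ← add_mul, htt, one_mul]
  have hsandwich : σ w * (σ y * y) * w = σ w + w := by
    rw [← hsum, mul_add, add_mul, mul_assoc, huw, hwu, mul_one, one_mul]
  rw [← hw, hsub, hone, hmul, hmul, hinv]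
  calc (1 - y * (σ w * σ y)) * (1 - y * w * σ y)
      = 1 - y * (σ w + w) * σ y + y * (σ w * (σ y * y) * w) * σ y := by noncomm_ring
    _ = 1 := by rw [hsandwich, sub_add_cancel]
end

section
/- Let R be a commutative semilocal ring with 2 ∈ R^×, let Q be a finitely generated projective R-module of positive rank at every maximal ideal, and let g : Q × Q → R be a unimodular symmetric bilinear form (i.e. x ↦ g(x,−) : Q → Hom_R(Q,R) is bijective). Then there exists x ∈ Q with g(x,x) ∈ R^×. -/
open scoped TensorProduct

universe u v

/-- If every linear functional on a projective module takes values in the ideal `I`, then the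
base change of the module to `R ⧸ I` vanishes. -/
theorem subsingleton_quotient_tensor_of_forall_dual_mem
    {R : Type u} {Q : Type v} [CommRing R] [AddCommGroup Q] [Module R Q] [Module.Projective R Q]
    (I : Ideal R) (h : ∀ (f : Q →ₗ[R] R) (x : Q), f x ∈ I) :
    Subsingleton ((R ⧸ I) ⊗[R] Q) := by
  obtain ⟨s, hs⟩ := Module.projective_def.mp (inferInstance : Module.Projective R Q)
  refine subsingleton_of_forall_eq 0 fun t => ?_
  induction t with
  | zero => rfl
  | add a b ha hb => rw [ha, hb, add_zero]
  | tmul a x =>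
    rw [← hs x, Finsupp.linearCombination_apply, Finsupp.sum, TensorProduct.tmul_sum]
    refine Finset.sum_eq_zero fun q _ => ?_
    have hq : s x q ∈ I := h (Finsupp.lapply q ∘ₗ s) x
    rw [← TensorProduct.smul_tmul, Algebra.smul_def, Ideal.Quotient.algebraMap_eq,
      Ideal.Quotient.eq_zero_iff_mem.mpr hq, zero_mul, TensorProduct.zero_tmul]

/-- A symmetric bilinear form whose diagonal takes values in an ideal takes all its values in that
ideal, provided `2` is invertible. -/
theorem bilin_apply_mem_of_forall_self_mem
    {R : Type u} {Q : Type v} [CommRing R] [AddCommGroup Q] [Module R Q]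
    (h2 : IsUnit (2 : R)) (g : Q →ₗ[R] Q →ₗ[R] R) (hsymm : ∀ x y : Q, g x y = g y x)
    (I : Ideal R) (h : ∀ x : Q, g x x ∈ I) (x y : Q) : g x y ∈ I := by
  have hpolar : g (x + y) (x + y) - g x x - g y y = 2 * g x y := by
    simp only [map_add, LinearMap.add_apply, hsymm y x]
    ring
  rw [← Ideal.unit_mul_mem_iff_mem I h2, ← hpolar]
  exact I.sub_mem (I.sub_mem (h _) (h x)) (h y)

/-- Chinese remainder theorem for the diagonal of a bilinear form: vectors prescribed at each of
finitely many pairwise coprime ideals can be interpolated by a single vector. -/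
theorem exists_forall_bilin_self_sub_mem
    {R : Type u} {Q : Type v} [CommRing R] [AddCommGroup Q] [Module R Q]
    {ι : Type*} [Finite ι] (I : ι → Ideal R) (hI : Pairwise fun i j => IsCoprime (I i) (I j))
    (g : Q →ₗ[R] Q →ₗ[R] R) (x : ι → Q) :
    ∃ z : Q, ∀ i, g z z - g (x i) (x i) ∈ I i := by
  classical
  have := Fintype.ofFinite ι
  have hr : ∀ i, ∃ r : R, ∀ j, Ideal.Quotient.mk (I j) r = if j = i then 1 else 0 := by
    intro i
    obtain ⟨r, hr⟩ := Ideal.pi_quotient_surjective hI fun j => if j = i then 1 else 0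
    exact ⟨r, fun j => hr j⟩
  choose r hr using hr
  refine ⟨∑ i, r i • x i, fun j => ?_⟩
  rw [← Ideal.Quotient.eq]
  simp [LinearMap.sum_apply, hr]

/-- **Lemma.** Let `R` be a commutative semilocal ring with `2 ∈ Rˣ`, let `Q` be a finitely
generated projective `R`-module of positive rank at every maximal ideal, and let
`g : Q × Q → R` be a unimodular symmetric bilinear form. Then there exists `x ∈ Q` with
`g(x,x) ∈ Rˣ`. -/
theorem exists_vector_with_unit_norm
    (R : Type u) (Q : Type v) [CommRing R] [AddCommGroup Q] [Module R Q]
    (hsemilocal : Finite {I : Ideal R // I.IsMaximal})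
    (h2 : IsUnit (2 : R))
    (hfin : Module.Finite R Q)
    (hproj : Module.Projective R Q)
    (hrank : ∀ m : {I : Ideal R // I.IsMaximal},
      0 < Module.finrank (R ⧸ m.1) ((R ⧸ m.1) ⊗[R] Q))
    (g : Q →ₗ[R] Q →ₗ[R] R)
    (hsymm : ∀ x y : Q, g x y = g y x)
    (hunimodular : Function.Bijective fun x : Q => g x) :
    ∃ x : Q, IsUnit (g x x) := by
  have hlocal : ∀ m : {I : Ideal R // I.IsMaximal}, ∃ x : Q, g x x ∉ m.1 := by
    intro m
    by_contra! h
    have : Subsingleton ((R ⧸ m.1) ⊗[R] Q) := by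
      refine subsingleton_quotient_tensor_of_forall_dual_mem m.1 fun f y => ?_
      obtain ⟨x, rfl⟩ := hunimodular.surjective f
      exact bilin_apply_mem_of_forall_self_mem h2 g hsymm m.1 h x y
    have : Nontrivial (R ⧸ m.1) := Ideal.Quotient.nontrivial_iff.mpr m.2.ne_top
    exact (hrank m).ne' Module.finrank_zero_of_subsingleton
  choose x hx using hlocal
  obtain ⟨z, hz⟩ := exists_forall_bilin_self_sub_mem
    (fun m : {I : Ideal R // I.IsMaximal} => m.1)
    (fun m n hmn => Ideal.isCoprime_iff_sup_eq.mpr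
      (m.2.coprime_of_ne n.2 fun h => hmn (Subtype.ext h))) g x
  refine ⟨z, ?_⟩
  by_contra hunit
  obtain ⟨m, hm, hzm⟩ := exists_max_ideal_of_mem_nonunits hunit
  exact hx ⟨m, hm⟩ ((m.sub_mem_iff_right hzm).mp (hz ⟨m, hm⟩))
end

section
/- Let R be an integral domain with 2 ∈ R^× and fraction field F, let L ⊆ F be an invertible fractional ideal, let A = [[R, L^{−1}],[L, R]] ⊆ M₂(F) and let σ([[a,b],[c,d]]) = [[d,b],[c,a]]. Then every element u ∈ O(A,σ) with determinant (reduced norm) −1 is of the form [[0, x^{−1}],[x, 0]] for some x ∈ L, and the existence of such an element forces L = xR, i.e. L is principal. -/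
universe u

/-- **Lemma (computation in Example 5).** Let `R` be an integral domain with `2 ∈ Rˣ` and
fraction field `F`, let `L ⊆ F` be an invertible fractional ideal, let
`A = [[R, L⁻¹],[L, R]] ⊆ M₂(F)` and `σ([[a,b],[c,d]]) = [[d,b],[c,a]]`. Then every
`u ∈ O(A,σ)` with determinant (reduced norm) `-1` has the form `[[0, x⁻¹],[x, 0]]` for some
`x ∈ L`, and the existence of such an element forces `L = xR`, i.e. `L` is principal. -/
theorem orthogonal_det_neg_one_is_antidiagonal_and_L_principal
    (R F : Type u) [CommRing R] [IsDomain R] [Field F] [Algebra R F] [IsFractionRing R F]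
    (h2 : IsUnit (2 : R))
    (L : FractionalIdeal (nonZeroDivisors R) F)
    (hLinv : L * (1 / L) = 1)
    (u : Matrix (Fin 2) (Fin 2) F)
    (humem : u 0 0 ∈ (1 : FractionalIdeal (nonZeroDivisors R) F) ∧ u 0 1 ∈ 1 / L ∧
             u 1 0 ∈ L ∧ u 1 1 ∈ (1 : FractionalIdeal (nonZeroDivisors R) F))
    (hO : (!![u 1 1, u 0 1; u 1 0, u 0 0] : Matrix (Fin 2) (Fin 2) F) * u = 1)
    (hdet : u.det = -1) :
    ∃ x : F, x ∈ L ∧ u = !![0, x⁻¹; x, 0] ∧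
      L = FractionalIdeal.spanSingleton (nonZeroDivisors R) x := by
  obtain ⟨-, hb, hc, -⟩ := humem
  have h2F : (2 : F) ≠ 0 := by
    simpa only [map_ofNat] using (h2.map (algebraMap R F)).ne_zero
  have h00 := congrFun (congrFun hO 0) 0
  have h01 := congrFun (congrFun hO 0) 1
  have h10 := congrFun (congrFun hO 1) 0
  simp only [Matrix.mul_apply, Fin.sum_univ_two, Matrix.of_apply, Matrix.cons_val_zero,
    Matrix.cons_val_one, Matrix.cons_val', Matrix.cons_val_fin_one, Matrix.one_apply_eq,
    ne_eq, zero_ne_one, one_ne_zero, not_false_eq_true, Matrix.one_apply_ne] at h00 h01 h10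
  rw [Matrix.det_fin_two] at hdet
  have hbc : u 0 1 * u 1 0 = 1 := mul_left_cancel₀ h2F (by linear_combination h00 - hdet)
  have hd : u 1 1 = 0 :=
    mul_left_cancel₀ h2F (by linear_combination u 1 0 * h01 - 2 * u 1 1 * hbc)
  have ha : u 0 0 = 0 :=
    mul_left_cancel₀ h2F (by linear_combination u 0 1 * h10 - 2 * u 0 0 * hbc)
  have hL0 : L ≠ 0 := by
    rintro rfl
    simp at hLinv
  refine ⟨u 1 0, hc, ?_, le_antisymm (fun y hy => ?_) ?_⟩
  · have hinv := eq_inv_of_mul_eq_one_left hbc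
    ext i j
    fin_cases i <;> fin_cases j
    exacts [ha, hinv, rfl, hd]
  · obtain ⟨r, hr⟩ := (FractionalIdeal.mem_one_iff _).1
      ((FractionalIdeal.mem_div_iff_of_ne_zero hL0).1 hb y hy)
    refine (FractionalIdeal.mem_spanSingleton _).2 ⟨r, ?_⟩
    rw [Algebra.smul_def, hr]
    linear_combination y * hbc
  · exact FractionalIdeal.spanSingleton_le_iff_mem.2 hc
end

section
/- Let R be an integral domain with fraction field F, let L and M be invertible fractional ideals of R such that R ⊕ L ≅ M ⊕ M as R-modules, and let A = [[R, L^{−1}],[L, R]] ⊆ M₂(F). Then A ≅ End_R(M ⊕ M) ≅ M₂(R) as R-algebras. -/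
set_option synthInstance.maxHeartbeats 1000000
set_option maxHeartbeats 1000000

universe u

namespace FractionalIdeal

open nonZeroDivisors

variable {R F : Type*} [CommRing R] [IsDomain R] [Field F] [Algebra R F] [IsFractionRing R F]

/-- Every linear map from a fractional ideal to the fraction field is a multiplication. -/
theorem exists_forall_apply_eq_mul (I : FractionalIdeal R⁰ F)
    (f : ↥(I : Submodule R F) →ₗ[R] F) : ∃ c : F, ∀ x, f x = c * x := by
  have cross (x y : ↥(I : Submodule R F)) : f x * y = f y * x := by
    obtain ⟨⟨a, s⟩, hs⟩ := IsLocalization.surj R⁰ (x : F)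
    obtain ⟨⟨b, t⟩, ht⟩ := IsLocalization.surj R⁰ (y : F)
    have hs0 : algebraMap R F s ≠ 0 := IsFractionRing.to_map_ne_zero_of_mem_nonZeroDivisors s.2
    have ht0 : algebraMap R F t ≠ 0 := IsFractionRing.to_map_ne_zero_of_mem_nonZeroDivisors t.2
    have hxy : (b * s : R) • x = (a * t : R) • y := by
      ext
      simp only [Submodule.coe_smul, Algebra.smul_def, map_mul]
      linear_combination algebraMap R F b * hs - algebraMap R F a * ht
    have hf := congrArg f hxy
    simp only [map_smul, Algebra.smul_def, map_mul] at hf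
    refine mul_left_cancel₀ (mul_ne_zero hs0 ht0) ?_
    simp only at hs ht
    linear_combination hf + algebraMap R F s * f x * ht - algebraMap R F t * f y * hs
  by_cases h : ∃ y : ↥(I : Submodule R F), (y : F) ≠ 0
  · obtain ⟨y, hy⟩ := h
    refine ⟨f y / y, fun x ↦ ?_⟩
    rw [div_mul_eq_mul_div, eq_div_iff hy, cross x y]
  · push Not at h
    refine ⟨0, fun x ↦ ?_⟩
    rw [show x = 0 from Subtype.ext (h x), map_zero, zero_mul]

theorem div_self_of_mul_one_div_eq_one {I : FractionalIdeal R⁰ F} (h : I * (1 / I) = 1) :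
    I / I = 1 := by
  have hI : I ≠ 0 := by
    rintro rfl
    simp at h
  apply le_antisymm
  · calc I / I = I / I * (I * (1 / I)) := by rw [h, mul_one]
      _ = (I / I * I) * (1 / I) := (mul_assoc _ _ _).symm
      _ ≤ I * (1 / I) := by
        gcongr
        exact (le_div_iff_mul_le hI).mp le_rfl
      _ = 1 := h
  · rw [le_div_iff_mul_le hI, one_mul]

variable {ι : Type*} [Fintype ι] [DecidableEq ι]

/-- A matrix with entries in the colon ideals `I i / I j` acts on the product of the `I i`. -/
noncomputable def matrixToEnd (I : ι → FractionalIdeal R⁰ F) (hI : ∀ i, I i ≠ 0)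
    (B : Subalgebra R (Matrix ι ι F)) (hB : ∀ X ∈ B, ∀ i j, X i j ∈ I i / I j) :
    B →ₐ[R] Module.End R (∀ i, ↥(I i : Submodule R F)) :=
  AlgHom.ofLinearMap
    { toFun X :=
        { toFun v i := ⟨∑ j, X.1 i j * v j, Submodule.sum_mem _ fun j _ ↦
            (mem_div_iff_of_ne_zero (hI j)).mp (hB X.1 X.2 i j) _ (v j).2⟩
          map_add' v w := by
            ext i
            simp [mul_add, Finset.sum_add_distrib]
          map_smul' r v := by
            ext i
            simp [Finset.smul_sum] }
      map_add' X Y := by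
        refine LinearMap.ext fun v ↦ funext fun i ↦ Subtype.ext ?_
        simp [add_mul, Finset.sum_add_distrib]
      map_smul' r X := by
        refine LinearMap.ext fun v ↦ funext fun i ↦ Subtype.ext ?_
        simp [Finset.smul_sum] }
    (by
      refine LinearMap.ext fun v ↦ funext fun i ↦ Subtype.ext ?_
      simp [Matrix.one_apply])
    (by
      intro X Y
      refine LinearMap.ext fun v ↦ funext fun i ↦ Subtype.ext ?_
      simpa [Matrix.mulVec, dotProduct] using
        congrFun (Matrix.mulVec_mulVec (fun j ↦ (v j : F)) X.1 Y.1).symm i)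

@[simp]
theorem coe_matrixToEnd_apply (I : ι → FractionalIdeal R⁰ F) (hI : ∀ i, I i ≠ 0)
    (B : Subalgebra R (Matrix ι ι F)) (hB : ∀ X ∈ B, ∀ i j, X i j ∈ I i / I j) (X : B)
    (v : ∀ i, ↥(I i : Submodule R F)) (i : ι) :
    (matrixToEnd I hI B hB X v i : F) = ∑ j, X.1 i j * v j :=
  rfl

theorem coe_matrixToEnd_single (I : ι → FractionalIdeal R⁰ F) (hI : ∀ i, I i ≠ 0)
    (B : Subalgebra R (Matrix ι ι F)) (hB : ∀ X ∈ B, ∀ i j, X i j ∈ I i / I j) (X : B)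
    (i j : ι) (x : ↥(I j : Submodule R F)) :
    (matrixToEnd I hI B hB X (Pi.single j x) i : F) = X.1 i j * x := by
  rw [coe_matrixToEnd_apply, Finset.sum_eq_single j]
  · simp
  · intro k _ hk
    simp [Pi.single_eq_of_ne hk]
  · simp

theorem matrixToEnd_bijective (I : ι → FractionalIdeal R⁰ F) (hI : ∀ i, I i ≠ 0)
    (B : Subalgebra R (Matrix ι ι F)) (hB : ∀ X, X ∈ B ↔ ∀ i j, X i j ∈ I i / I j) :
    Function.Bijective (matrixToEnd I hI B fun X ↦ (hB X).mp) := by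
  constructor
  · intro X Y h
    ext i j
    obtain ⟨x, hx, hx0⟩ := Submodule.exists_mem_ne_zero_of_ne_bot
      (mt coeToSubmodule_eq_bot.mp (hI j))
    have := congrArg (fun f ↦ (f (Pi.single j ⟨x, hx⟩) i : F)) h
    simp only [coe_matrixToEnd_single] at this
    exact mul_right_cancel₀ hx0 this
  · intro f
    choose c hc using fun i j ↦ exists_forall_apply_eq_mul (I j)
      ((I i : Submodule R F).subtype ∘ₗ LinearMap.proj i ∘ₗ f ∘ₗ
        LinearMap.single R (fun i ↦ ↥(I i : Submodule R F)) j)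
    have hcB : Matrix.of c ∈ B := (hB _).mpr fun i j ↦
      (mem_div_iff_of_ne_zero (hI j)).mpr fun y hy ↦ by
        have := hc i j ⟨y, hy⟩
        rw [Matrix.of_apply, ← this]
        exact Subtype.prop _
    refine ⟨⟨_, hcB⟩, LinearMap.pi_ext fun j x ↦ funext fun i ↦ Subtype.ext ?_⟩
    rw [coe_matrixToEnd_single]
    exact (hc i j x).symm

/-- The matrices with entries in the colon ideals `I i / I j` are the endomorphisms of the
product of the `I i`. -/
noncomputable def matrixEquivEnd (I : ι → FractionalIdeal R⁰ F) (hI : ∀ i, I i ≠ 0)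
    (B : Subalgebra R (Matrix ι ι F)) (hB : ∀ X, X ∈ B ↔ ∀ i j, X i j ∈ I i / I j) :
    B ≃ₐ[R] Module.End R (∀ i, ↥(I i : Submodule R F)) :=
  AlgEquiv.ofBijective _ (matrixToEnd_bijective I hI B hB)

/-- The linear equivalence between the base ring and the unit fractional ideal. -/
noncomputable def oneEquiv : R ≃ₗ[R] ↥((1 : FractionalIdeal R⁰ F) : Submodule R F) :=
  LinearEquiv.ofInjective (Algebra.linearMap R F) (IsFractionRing.injective R F) ≪≫ₗ
    LinearEquiv.ofEq _ _ (by rw [coe_one, Submodule.one_eq_range])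

variable (ι) in
/-- The endomorphisms of a power of an invertible fractional ideal are the matrices over `R`. -/
theorem nonempty_end_equiv_matrix {M : FractionalIdeal R⁰ F} (hM : M * (1 / M) = 1) :
    Nonempty (Module.End R (ι → ↥(M : Submodule R F)) ≃ₐ[R] Matrix ι ι R) := by
  have hM0 : M ≠ 0 := by
    rintro rfl
    simp at hM
  let f : Matrix ι ι R →ₐ[R] Matrix ι ι F := (Algebra.ofId R F).mapMatrix
  have hf : Function.Injective f := Matrix.map_injective (IsFractionRing.injective R F)
  have hB (X : Matrix ι ι F) : X ∈ f.range ↔ ∀ i j : ι, X i j ∈ M / M := by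
    simp only [div_self_of_mul_one_div_eq_one hM, mem_one_iff]
    constructor
    · rintro ⟨Y, rfl⟩ i j
      exact ⟨Y i j, rfl⟩
    · intro h
      choose Y hY using h
      exact ⟨Matrix.of Y, Matrix.ext hY⟩
  exact ⟨((AlgEquiv.ofInjective f hf).trans (matrixEquivEnd _ (fun _ ↦ hM0) f.range hB)).symm⟩

end FractionalIdeal

/-- **Remark (Example 5).** Let `R` be an integral domain with fraction field `F`, let `L`
and `M` be invertible fractional ideals of `R` with `R ⊕ L ≅ M ⊕ M` as `R`-modules, and let
`A = [[R, L⁻¹],[L, R]] ⊆ M₂(F)`. Then `A ≅ End_R(M ⊕ M) ≅ M₂(R)` as `R`-algebras. -/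
theorem matrix_algebra_of_square_class
    (R F : Type u) [CommRing R] [IsDomain R] [Field F] [Algebra R F] [IsFractionRing R F]
    (L M : FractionalIdeal (nonZeroDivisors R) F)
    (hLinv : L * (1 / L) = 1)
    (hMinv : M * (1 / M) = 1)
    (hiso : Nonempty ((R × ↥(L : Submodule R F)) ≃ₗ[R]
      (↥(M : Submodule R F) × ↥(M : Submodule R F))))
    (B : Subalgebra R (Matrix (Fin 2) (Fin 2) F))
    (hB : ∀ X : Matrix (Fin 2) (Fin 2) F, X ∈ B ↔
      (X 0 0 ∈ (1 : FractionalIdeal (nonZeroDivisors R) F) ∧ X 0 1 ∈ 1 / L ∧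
       X 1 0 ∈ L ∧ X 1 1 ∈ (1 : FractionalIdeal (nonZeroDivisors R) F))) :
    Nonempty (B ≃ₐ[R] Module.End R (↥(M : Submodule R F) × ↥(M : Submodule R F))) ∧
    Nonempty (B ≃ₐ[R] Matrix (Fin 2) (Fin 2) R) := by
  have hL0 : L ≠ 0 := by
    rintro rfl
    simp at hLinv
  have hI : ∀ i, (![1, L] : Fin 2 → FractionalIdeal (nonZeroDivisors R) F) i ≠ 0 := by
    simp [Fin.forall_fin_two, hL0]
  have hB' (X : Matrix (Fin 2) (Fin 2) F) : X ∈ B ↔ ∀ i j,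
      X i j ∈ (![1, L] : Fin 2 → FractionalIdeal (nonZeroDivisors R) F) i / ![1, L] j := by
    simp [hB, Fin.forall_fin_two, FractionalIdeal.div_one,
      FractionalIdeal.div_self_of_mul_one_div_eq_one hLinv, and_assoc]
  obtain ⟨e⟩ := hiso
  let e₁ : (∀ i, ↥((![1, L] : Fin 2 → FractionalIdeal (nonZeroDivisors R) F) i : Submodule R F))
      ≃ₗ[R] ↥(M : Submodule R F) × ↥(M : Submodule R F) :=
    LinearEquiv.piFinTwo R _ ≪≫ₗ
      FractionalIdeal.oneEquiv.symm.prodCongr (LinearEquiv.refl R ↥(L : Submodule R F)) ≪≫ₗ e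
  let φ := (FractionalIdeal.matrixEquivEnd _ hI B hB').trans (e₁.conjAlgEquiv R)
  obtain ⟨ψ⟩ := FractionalIdeal.nonempty_end_equiv_matrix (Fin 2) hMinv
  exact ⟨⟨φ⟩, ⟨(φ.trans ((LinearEquiv.finTwoArrow R _).symm.conjAlgEquiv R)).trans ψ⟩⟩
end
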